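/- For all integers k, l ≥ 0, every function F : ℂ^m × ℂ^r → ℂ, and every point (x, y) ∈ ℂ^m × ℂ^r that is admissible for the identity (every bracket value occurring in a denominator of any coefficient of either iterated sum is nonzero), the operators D_{m,r}^{(k)} and H_{m,r}^{(l)} commute: (D_{m,r}^{(k)} (H_{m,r}^{(l)} F))(x; y) = (H_{m,r}^{(l)} (D_{m,r}^{(k)} F))(x; y). -/

import Mathlib

open Finset

/-- Shifted factorial `[x; a]_k` for `k ∈ ℤ`:
`[x; a]_k = [x][x+a]⋯[x+(k-1)a]` for `k ≥ 0` and `[x; a]_{-k} = 1/[x-ka; a]_k`. -/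
noncomputable def sfac (br : ℂ → ℂ) (a x : ℂ) (k : ℤ) : ℂ :=
  if 0 ≤ k then ∏ i ∈ Finset.range k.toNat, br (x + (i : ℂ) * a)
  else (∏ i ∈ Finset.range (-k).toNat, br (x + ((k : ℂ) + (i : ℂ)) * a))⁻¹

/-- The coefficient `C_{μ,I}(x; y; a, b)`. -/
noncomputable def Coef (br : ℂ → ℂ) (a b : ℂ) {m r : ℕ} (μ : Fin m → ℕ)
    (I : Finset (Fin r)) (x : Fin m → ℂ) (y : Fin r → ℂ) : ℂ :=
  (-1 : ℂ) ^ I.card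
    * (∏ i : Fin m, ∏ j : Fin m,
        if i < j then br (x i - x j + ((μ i : ℂ) - (μ j : ℂ)) * a) / br (x i - x j) else 1)
    * (∏ i ∈ I, ∏ j ∈ Iᶜ, br (y i - y j - a) / br (y i - y j))
    * (∏ i : Fin m, ∏ j : Fin m,
        sfac br a (x i - x j + b) (μ i : ℤ) / sfac br a (x i - x j + a) (μ i : ℤ))
    * ∏ i : Fin m,
        ((∏ j ∈ I, br (x i - y j - b) / br (x i - y j + (μ i : ℂ) * a))
          * ∏ j ∈ Iᶜ, br (x i - y j - a) / br (x i - y j + ((μ i : ℂ) - 1) * a))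

/-- Index set of the sums: pairs `(μ, I)` with `μ ∈ ℤ_{≥0}^m`, `I ⊆ {1,…,r}`, `|μ|+|I| = k`. -/
def idxSet (m r k : ℕ) : Finset ((Fin m → ℕ) × Finset (Fin r)) :=
  ((Fintype.piFinset fun _ : Fin m => Finset.range (k + 1)) ×ˢ
      (Finset.univ : Finset (Finset (Fin r)))).filter
    fun p => (∑ i, p.1 i) + p.2.card = k

def xshift (c : ℂ) {m : ℕ} (μ : Fin m → ℕ) (x : Fin m → ℂ) : Fin m → ℂ :=
  fun i => x i + c * (μ i : ℂ)

def xshiftI (c : ℂ) {m : ℕ} (I : Finset (Fin m)) (x : Fin m → ℂ) : Fin m → ℂ :=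
  fun i => x i + c * (if i ∈ I then 1 else 0)

def yshift (c : ℂ) {r : ℕ} (I : Finset (Fin r)) (y : Fin r → ℂ) : Fin r → ℂ :=
  fun j => y j - c * (if j ∈ I then 1 else 0)

def yshiftMu (c : ℂ) {r : ℕ} (μ : Fin r → ℕ) (y : Fin r → ℂ) : Fin r → ℂ :=
  fun j => y j - c * (μ j : ℂ)

/-- The deformed elliptic Ruijsenaars operator `H_{m,r}^{(k)}`. -/
noncomputable def Hop (br : ℂ → ℂ) (δ κ : ℂ) (m r k : ℕ)
    (F : (Fin m → ℂ) → (Fin r → ℂ) → ℂ) (x : Fin m → ℂ) (y : Fin r → ℂ) : ℂ :=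
  ∑ p ∈ idxSet m r k, Coef br δ κ p.1 p.2 x y * F (xshift δ p.1 x) (yshift κ p.2 y)

/-- The operator `D_{m,r}^{(k)}`. -/
noncomputable def Dop (br : ℂ → ℂ) (δ κ : ℂ) (m r k : ℕ)
    (F : (Fin m → ℂ) → (Fin r → ℂ) → ℂ) (x : Fin m → ℂ) (y : Fin r → ℂ) : ℂ :=
  ∑ p ∈ idxSet r m k, Coef br (-κ) (-δ) p.1 p.2 y x * F (xshiftI δ p.2 x) (yshiftMu κ p.1 y)

/-- The operator `Ĥ_{m,r}^{(k)}`. -/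
noncomputable def Hhat (br : ℂ → ℂ) (δ κ : ℂ) (m r k : ℕ)
    (F : (Fin m → ℂ) → (Fin r → ℂ) → ℂ) (x : Fin m → ℂ) (y : Fin r → ℂ) : ℂ :=
  ∑ p ∈ idxSet m r k,
    Coef br (-δ) (-κ) p.1 p.2 (fun i => x i - δ) (fun j => y j + κ)
      * F (xshift (-δ) p.1 x) (yshift (-κ) p.2 y)

/-- The operator `D̂_{m,r}^{(k)}`. -/
noncomputable def Dhat (br : ℂ → ℂ) (δ κ : ℂ) (m r k : ℕ)
    (F : (Fin m → ℂ) → (Fin r → ℂ) → ℂ) (x : Fin m → ℂ) (y : Fin r → ℂ) : ℂ :=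
  ∑ p ∈ idxSet r m k,
    Coef br κ δ p.1 p.2 (fun j => y j + κ) (fun i => x i - δ)
      * F (xshiftI (-δ) p.2 x) (yshiftMu (-κ) p.1 y)

/-- Nonvanishing of all bracket values occurring in denominators of `C_{μ,I}(x; y; a, b)`. -/
def CDenomNZ (br : ℂ → ℂ) (a : ℂ) {m r : ℕ} (μ : Fin m → ℕ)
    (I : Finset (Fin r)) (x : Fin m → ℂ) (y : Fin r → ℂ) : Prop :=
  (∀ i j : Fin m, i < j → br (x i - x j) ≠ 0)
    ∧ (∀ i ∈ I, ∀ j ∈ Iᶜ, br (y i - y j) ≠ 0)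
    ∧ (∀ i j : Fin m, sfac br a (x i - x j + a) (μ i : ℤ) ≠ 0)
    ∧ (∀ i : Fin m, ∀ j ∈ I, br (x i - y j + (μ i : ℂ) * a) ≠ 0)
    ∧ (∀ i : Fin m, ∀ j ∈ Iᶜ, br (x i - y j + ((μ i : ℂ) - 1) * a) ≠ 0)

section OrderedPairs

variable {ι M : Type*} [Fintype ι] [LinearOrder ι] [CommMonoid M]

lemma prod_prod_eq_prod_pairs (F : ι → ι → M) :
    ∏ i, ∏ j, F i j
      = ∏ i, ∏ j, if i < j then F i j * F j i else if i = j then F i i else 1 := by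
  have h : ∀ i j, F i j = ((if i < j then F i j else 1) * (if i = j then F i i else 1))
      * (if j < i then F i j else 1) := by
    intro i j
    rcases lt_trichotomy i j with h | h | h
    · simp [h, h.ne, h.not_gt]
    · simp [h]
    · simp [h, h.ne', h.not_gt]
  calc ∏ i, ∏ j, F i j
      = (∏ i, ∏ j, ((if i < j then F i j else 1) * (if i = j then F i i else 1)))
        * ∏ i, ∏ j, (if j < i then F i j else 1) := by
        simp_rw [← prod_mul_distrib, ← h]
    _ = (∏ i, ∏ j, ((if i < j then F i j else 1) * (if i = j then F i i else 1)))
        * ∏ i, ∏ j, (if i < j then F j i else 1) := by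
        congr 1
        exact prod_comm
    _ = _ := by
        simp_rw [← prod_mul_distrib]
        refine prod_congr rfl fun i _ => prod_congr rfl fun j _ => ?_
        rcases lt_trichotomy i j with h | h | h
        · simp [h, h.ne]
        · simp [h]
        · simp [h.ne', h.not_gt]

/-- Two products over ordered pairs agree as soon as they agree on the diagonal and on every
unordered pair. -/
lemma prod_prod_eq_of_pairs (F G : ι → ι → M) (hd : ∀ i, F i i = G i i)
    (hp : ∀ i j, i < j → F i j * F j i = G i j * G j i) :
    ∏ i, ∏ j, F i j = ∏ i, ∏ j, G i j := by
  rw [prod_prod_eq_prod_pairs F, prod_prod_eq_prod_pairs G]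
  refine prod_congr rfl fun i _ => prod_congr rfl fun j _ => ?_
  split_ifs with h h'
  · exact hp i j h
  · exact hd i
  · rfl

end OrderedPairs

section Density

lemma dense_br_ne_zero {br : ℂ → ℂ} (hent : Differentiable ℂ br) (hnz : br ≠ 0) :
    Dense {z | br z ≠ 0} := by
  intro z
  by_contra hz
  have h0 : br =ᶠ[nhds z] 0 := by
    rw [mem_closure_iff_frequently] at hz
    simp only [Set.mem_ofPred_eq, Filter.not_frequently, not_not] at hz
    exact hz
  have han : AnalyticOnNhd ℂ br Set.univ := fun w _ => hent.analyticAt w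
  exact hnz (funext fun w =>
    han.eqOn_zero_of_preconnected_of_eventuallyEq_zero isPreconnected_univ (Set.mem_univ z) h0
      (Set.mem_univ w))

/-- For countably many nonzero linear forms, the points at which no form is sent to a zero of
`br` are dense. -/
lemma dense_forall_br_linear_ne_zero {br : ℂ → ℂ} (hent : Differentiable ℂ br) (hnz : br ≠ 0)
    {E ι : Type*} [NormedAddCommGroup E] [NormedSpace ℂ E] [CompleteSpace E] [Countable ι]
    (L : ι → E →L[ℂ] ℂ) (hL : ∀ i, L i ≠ 0) (a : ι → ℂ) :
    Dense {p : E | ∀ i, br (L i p + a i) ≠ 0} := by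
  rw [show {p : E | ∀ i, br (L i p + a i) ≠ 0} = ⋂ i, {p | br (L i p + a i) ≠ 0} by
    ext; simp]
  refine dense_iInter_of_isOpen (fun i => ?_) (fun i => ?_)
  · have hc : Continuous fun p => br (L i p + a i) :=
      hent.continuous.comp ((L i).continuous.add continuous_const)
    exact isOpen_ne.preimage hc
  · have hs : Function.Surjective (L i) := by
      refine LinearMap.surjective (f := (L i : E →ₗ[ℂ] ℂ)) ?_
      intro h
      exact hL i (ContinuousLinearMap.coe_injective h)
    have ho : IsOpenMap fun p => L i p + a i :=
      (isOpenMap_add_right (a i)).comp ((L i).isOpenMap hs)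
    exact (dense_br_ne_zero hent hnz).preimage ho

lemma dense_forall_br_add_ne_zero {br : ℂ → ℂ} (hent : Differentiable ℂ br) (hnz : br ≠ 0)
    {ι : Type*} [Countable ι] (a : ι → ℂ) : Dense {t : ℂ | ∀ i, br (t + a i) ≠ 0} := by
  have := dense_forall_br_linear_ne_zero hent hnz
    (fun _ : ι => ContinuousLinearMap.id ℂ ℂ) (fun _ h => by
      have := congrArg (fun f => f 1) h
      simp at this) a
  simpa using this

lemma eq_of_dense_of_continuousAt {E : Type*} [TopologicalSpace E] {S : Set E} (hS : Dense S)
    {f g : E → ℂ} {p : E} (hf : ContinuousAt f p) (hg : ContinuousAt g p)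
    (h : ∀ q ∈ S, f q = g q) : f p = g p := by
  have hfg : ContinuousAt (fun q => f q - g q) p := hf.sub hg
  have h1 := hfg.continuousWithinAt.mem_closure_image (hS p)
  have h2 : closure ((fun q => f q - g q) '' S) ⊆ {0} := by
    refine closure_minimal ?_ isClosed_singleton
    rintro _ ⟨q, hq, rfl⟩
    simp [h q hq]
  exact sub_eq_zero.mp (h2 h1)

end Density

section Frobenius

/-- The elliptic Cauchy product `∏_{i<j} [x_i-x_j][w_j-w_i] / ∏_{i,j} [x_i-w_j]`. -/
noncomputable def cauchyProd (br : ℂ → ℂ) {n : ℕ} (x w : Fin n → ℂ) : ℂ :=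
  (∏ i, ∏ j, if i < j then br (x i - x j) * br (w j - w i) else 1) / ∏ i, ∏ j, br (x i - w j)

/-- The matrix with entries `[t+x_i-w_j]/[x_i-w_j]`. -/
noncomputable def frobMatrix (br : ℂ → ℂ) (t : ℂ) {n : ℕ} (x w : Fin n → ℂ) :
    Matrix (Fin n) (Fin n) ℂ :=
  Matrix.of fun i j => br (t + (x i - w j)) / br (x i - w j)

variable {br : ℂ → ℂ}

lemma cauchyProd_succ {n : ℕ} (x w : Fin (n + 1) → ℂ) :
    cauchyProd br x w = cauchyProd br (fun i => x i.succ) (fun i => w i.succ)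
      * (∏ j : Fin n, br (x 0 - x j.succ) * br (w j.succ - w 0))
      / (br (x 0 - w 0) * (∏ j : Fin n, br (x 0 - w j.succ))
        * ∏ i : Fin n, br (x i.succ - w 0)) := by
  simp only [cauchyProd, Fin.prod_univ_succ, if_false, Fin.succ_pos, if_true,
    Fin.not_lt_zero, Fin.succ_lt_succ_iff, one_mul,
    prod_mul_distrib (f := fun i : Fin n => br (x i.succ - w 0))]
  rw [div_mul_eq_mul_div, div_div]
  congr 1 <;> ring

lemma det_eq_mul_det_of_pivot {n : ℕ} (A : Matrix (Fin (n + 1)) (Fin (n + 1)) ℂ)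
    (h : A 0 0 ≠ 0) :
    A.det = A 0 0
      * (Matrix.of fun i j : Fin n =>
          A i.succ j.succ - A i.succ 0 * A 0 j.succ / A 0 0).det := by
  let B : Matrix (Fin (n + 1)) (Fin (n + 1)) ℂ := Matrix.of fun i j =>
    A i j - (if i = 0 then 0 else A i 0 / A 0 0) * A 0 j
  have hAB : A.det = B.det := by
    refine Matrix.det_eq_of_forall_row_eq_smul_add_const
      (fun i => if i = 0 then 0 else A i 0 / A 0 0) 0 (by simp) fun i j => ?_
    simp [B]
  rw [hAB, Matrix.det_succ_column_zero, Fin.sum_univ_succ]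
  have hz : ∀ i : Fin n, B i.succ 0 = 0 := fun i => by
    simp [B, h]
  simp only [hz, mul_zero, zero_mul, sum_const_zero, add_zero]
  have : B.submatrix (Fin.succAbove 0) Fin.succ = Matrix.of fun i j : Fin n =>
          A i.succ j.succ - A i.succ 0 * A 0 j.succ / A 0 0 := by
    ext i j
    simp [B]
    ring
  rw [this]
  simp [B]

variable (hodd : ∀ z : ℂ, br (-z) = -br z)
    (hent : Differentiable ℂ br) (hnz : br ≠ 0)
    (hW : ∀ a b c d : ℂ,
      br (a + b) * br (a - b) * br (c + d) * br (c - d)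
        + br (a + d) * br (a - d) * br (b + c) * br (b - c)
        = br (a + c) * br (a - c) * br (b + d) * br (b - d))

include hodd hW in
lemma frobMatrix_schur (t x₀ w₀ x w : ℂ) (ht : br (t + (x₀ - w₀)) ≠ 0)
    (h10 : br (x - w₀) ≠ 0) (h01 : br (x₀ - w) ≠ 0)
    (h11 : br (x - w) ≠ 0) :
    br (t + (x - w)) / br (x - w)
        - br (t + (x - w₀)) / br (x - w₀) * (br (t + (x₀ - w)) / br (x₀ - w))
          / (br (t + (x₀ - w₀)) / br (x₀ - w₀))
      = (br t / br (t + (x₀ - w₀)) * (br (x₀ - x) / br (x - w₀)))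
        * ((br (w - w₀) / br (x₀ - w)) * (br (t + (x₀ - w₀) + (x - w)) / br (x - w))) := by
  have key := hW (t + (x₀ - w₀ + x - w) / 2) ((x₀ - w₀ + x - w) / 2)
    ((x - x₀ + w₀ - w) / 2) ((x - x₀ - w₀ + w) / 2)
  have e1 : br (x₀ - x) = - br (x - x₀) := by rw [← hodd]; ring_nf
  have e2 : br (w - w₀) = - br (w₀ - w) := by rw [← hodd]; ring_nf
  have c1 : t + (x₀ - w₀ + x - w) / 2 + (x₀ - w₀ + x - w) / 2
    = t + (x₀ - w₀) + (x - w) := by ring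
  have c2 : t + (x₀ - w₀ + x - w) / 2 - (x₀ - w₀ + x - w) / 2 = t := by ring
  have c3 : (x - x₀ + w₀ - w) / 2 + (x - x₀ - w₀ + w) / 2 = x - x₀ := by ring
  have c4 : (x - x₀ + w₀ - w) / 2 - (x - x₀ - w₀ + w) / 2 = w₀ - w := by ring
  have c5 : t + (x₀ - w₀ + x - w) / 2 + (x - x₀ - w₀ + w) / 2 = t + (x - w₀) := by ring
  have c6 : t + (x₀ - w₀ + x - w) / 2 - (x - x₀ - w₀ + w) / 2 = t + (x₀ - w) := by ring
  have c7 : (x₀ - w₀ + x - w) / 2 + (x - x₀ + w₀ - w) / 2 = x - w := by ring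
  have c8 : (x₀ - w₀ + x - w) / 2 - (x - x₀ + w₀ - w) / 2 = x₀ - w₀ := by ring
  have c9 : t + (x₀ - w₀ + x - w) / 2 + (x - x₀ + w₀ - w) / 2 = t + (x - w) := by ring
  have c10 : t + (x₀ - w₀ + x - w) / 2 - (x - x₀ + w₀ - w) / 2 = t + (x₀ - w₀) := by ring
  have c11 : (x₀ - w₀ + x - w) / 2 + (x - x₀ - w₀ + w) / 2 = x - w₀ := by ring
  have c12 : (x₀ - w₀ + x - w) / 2 - (x - x₀ - w₀ + w) / 2 = x₀ - w := by ring
  rw [c1, c2, c3, c4, c5, c6, c7, c8, c9, c10, c11, c12] at key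
  rw [e1, e2]
  field_simp
  linear_combination -key

include hodd hent hnz hW in
/-- Frobenius' determinant formula. -/
lemma br_mul_det_frobMatrix {n : ℕ} (x w : Fin n → ℂ) (h : ∀ i j, br (x i - w j) ≠ 0) (t : ℂ) :
    br t * (frobMatrix br t x w).det
      = br t ^ n * br (t + ∑ i, (x i - w i)) * cauchyProd br x w := by
  induction n generalizing t with
  | zero => simp [frobMatrix, cauchyProd]
  | succ n ih =>
    have hbr := hent.continuous
    have hS := dense_forall_br_add_ne_zero hent hnz (fun _ : Unit => x 0 - w 0)
    refine eq_of_dense_of_continuousAt hS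
      (f := fun t => br t * (frobMatrix br t x w).det)
      (g := fun t => br t ^ (n + 1) * br (t + ∑ i, (x i - w i)) * cauchyProd br x w) ?_ ?_ ?_
    · refine Continuous.continuousAt (hbr.mul (Continuous.matrix_det ?_))
      refine continuous_matrix fun i j => ?_
      simp only [frobMatrix, Matrix.of_apply]
      fun_prop
    · refine Continuous.continuousAt ?_
      fun_prop
    · intro t ht
      have ht := ht ()
      have hM : frobMatrix br t x w 0 0 ≠ 0 := by
        simp [frobMatrix, ht, h 0 0]
      have hsch : (Matrix.of fun i j : Fin n => frobMatrix br t x w i.succ j.succ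
          - frobMatrix br t x w i.succ 0 * frobMatrix br t x w 0 j.succ / frobMatrix br t x w 0 0)
          = Matrix.of fun i j : Fin n =>
            (br t / br (t + (x 0 - w 0)) * (br (x 0 - x i.succ) / br (x i.succ - w 0)))
            * (Matrix.of fun i j : Fin n => (br (w j.succ - w 0) / br (x 0 - w j.succ)) *
              frobMatrix br (t + (x 0 - w 0)) (fun i => x i.succ) (fun i => w i.succ) i j) i j := by
        ext i j
        simp only [frobMatrix, Matrix.of_apply]
        exact frobMatrix_schur hodd hW t _ _ _ _ ht (h _ _) (h _ _) (h _ _)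
      have ih' := ih (fun i => x i.succ) (fun i => w i.succ) (fun i j => h _ _) (t + (x 0 - w 0))
      rw [det_eq_mul_det_of_pivot _ hM, hsch, Matrix.det_mul_column, Matrix.det_mul_row,
        cauchyProd_succ, Fin.sum_univ_succ, ← add_assoc]
      have hd : (frobMatrix br (t + (x 0 - w 0)) (fun i => x i.succ) (fun i => w i.succ)).det
          = br (t + (x 0 - w 0)) ^ n * br (t + (x 0 - w 0) + ∑ i : Fin n, (x i.succ - w i.succ))
            * cauchyProd br (fun i => x i.succ) (fun i => w i.succ) / br (t + (x 0 - w 0)) := by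
        rw [← ih']; field_simp
      rw [hd]
      simp only [prod_mul_distrib, prod_div_distrib, prod_const, card_univ, Fintype.card_fin,
        frobMatrix, Matrix.of_apply]
      have h1 := h 0 0
      have h2 : ∏ i : Fin n, br (x i.succ - w 0) ≠ 0 := prod_ne_zero_iff.mpr fun i _ => h _ _
      have h3 : ∏ i : Fin n, br (x 0 - w i.succ) ≠ 0 := prod_ne_zero_iff.mpr fun i _ => h _ _
      field_simp
      ring

end Frobenius

section Duality

lemma sum_det_mix_rows_eq_cols {n R : Type*} [Fintype n] [DecidableEq n] [CommRing R]
    (A B : Matrix n n R) (s : ℕ) :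
    ∑ K ∈ powersetCard s univ, (Matrix.of fun i j => if i ∈ K then B i j else A i j).det
      = ∑ K ∈ powersetCard s univ, (Matrix.of fun i j => if j ∈ K then B i j else A i j).det := by
  simp only [Matrix.det_apply, Matrix.of_apply]
  rw [sum_comm, sum_comm (s := powersetCard s univ)]
  refine sum_congr rfl fun σ _ => ?_
  refine sum_equiv σ.symm.finsetCongr (fun K => by simp [mem_powersetCard]) fun K _ => ?_
  simp [Equiv.finsetCongr_apply]

/-- The vector `x + c 1_K`. -/
noncomputable def shiftOn {N : Type*} [DecidableEq N] (c : ℂ) (K : Finset N) (x : N → ℂ) :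
    N → ℂ :=
  fun i => if i ∈ K then x i + c else x i

/-- The summand of the duality transformation: the product over ordered pairs of
`[x_i-x_j+c]/[x_i-x_j]` for `i ∈ K`, `j ∉ K`, times `[x_i-w_j]` for `i ∈ K` and
`[x_i-w_j+c]` for `i ∉ K`. -/
noncomputable def dualTerm (br : ℂ → ℂ) {N : Type*} [Fintype N] [DecidableEq N] (c : ℂ)
    (x w : N → ℂ) (K : Finset N) : ℂ :=
  ∏ i, ∏ j, (if i ∈ K ∧ j ∉ K then br (x i - x j + c) / br (x i - x j) else 1)
    * (if i ∈ K then br (x i - w j) else br (x i - w j + c))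

variable {br : ℂ → ℂ} (hodd : ∀ z : ℂ, br (-z) = -br z)

include hodd in
lemma br_sub_comm (a b : ℂ) : br (a - b) = -br (b - a) := by
  rw [← hodd, neg_sub]

include hodd in
lemma dualTerm_mul_cauchyProd {n : ℕ} (c : ℂ) (x w : Fin n → ℂ) (K : Finset (Fin n))
    (hx : ∀ i j, i ≠ j → br (x i - x j) ≠ 0)
    (h0 : ∀ i j, br (x i - w j) ≠ 0) (h1 : ∀ i j, br (x i - w j + c) ≠ 0) :
    dualTerm br c x w K * cauchyProd br x w
      = (∏ i, ∏ j, br (x i - w j + c)) * cauchyProd br (shiftOn c K x) w := by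
  simp only [cauchyProd, dualTerm, ← prod_div_distrib, ← prod_mul_distrib]
  refine prod_prod_eq_of_pairs _ _ (fun i => ?_) (fun i j hij => ?_)
  · have := h0 i i
    have := h1 i i
    by_cases hi : i ∈ K
    · simp only [hi, shiftOn, if_true, lt_self_iff_false, if_false, not_true, and_false]
      rw [add_sub_right_comm]
      field_simp
    · simp only [hi, shiftOn, lt_self_iff_false, if_false, false_and]
      field_simp
  · have a1 := h0 i j
    have a2 := h1 i j
    have a3 := h0 j i
    have a4 := h1 j i
    have a5 := hx i j hij.ne
    have a6 := hx j i hij.ne'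
    have e : ∀ a b : ℂ, br (a + c - b) = br (a - b + c) := fun a b => by
      rw [add_sub_right_comm]
    have e' : ∀ a b : ℂ, br (a - (b + c)) = - br (b - a + c) := fun a b => by
      rw [← hodd]; ring_nf
    have e3 : br (x j - x i) = - br (x i - x j) := br_sub_comm hodd _ _
    rw [e3] at a6
    by_cases hi : i ∈ K <;> by_cases hj : j ∈ K <;>
    simp only [hi, hj, shiftOn, hij, hij.not_gt, if_true, if_false, not_true, not_false_iff,
      and_true, and_false, and_self, e, e', e3, add_sub_add_right_eq_sub] <;>
    field_simp

lemma cauchyProd_neg_neg {n : ℕ} (x w : Fin n → ℂ) :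
    cauchyProd br (-w) (-x) = cauchyProd br x w := by
  simp only [cauchyProd, Pi.neg_apply, neg_sub_neg]
  congr 1
  · simp only [mul_comm]
  · exact prod_comm

variable (hent : Differentiable ℂ br) (hnz : br ≠ 0)
    (hW : ∀ a b c d : ℂ,
      br (a + b) * br (a - b) * br (c + d) * br (c - d)
        + br (a + d) * br (a - d) * br (b + c) * br (b - c)
        = br (a + c) * br (a - c) * br (b + d) * br (b - d))

lemma frobMatrix_shiftOn {n : ℕ} (t c : ℂ) (x w : Fin n → ℂ) (K : Finset (Fin n)) :
    frobMatrix br t (shiftOn c K x) w = Matrix.of fun i j =>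
      if i ∈ K then frobMatrix br t (fun i => x i + c) w i j else frobMatrix br t x w i j := by
  ext i j
  by_cases h : i ∈ K <;> simp [frobMatrix, shiftOn, h]

lemma frobMatrix_shiftOn_right {n : ℕ} (t c : ℂ) (x w : Fin n → ℂ) (K : Finset (Fin n)) :
    frobMatrix br t x (shiftOn (-c) K w) = Matrix.of fun i j =>
      if j ∈ K then frobMatrix br t (fun i => x i + c) w i j else frobMatrix br t x w i j := by
  ext i j
  have e : x i - (w j + -c) = x i + c - w j := by ring
  by_cases h : j ∈ K <;> simp [frobMatrix, shiftOn, h, e]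

lemma sum_shiftOn {n : ℕ} (c : ℂ) (x : Fin n → ℂ) (K : Finset (Fin n)) :
    ∑ i, shiftOn c K x i = (∑ i, x i) + K.card * c := by
  have : ∀ i, shiftOn c K x i = x i + if i ∈ K then c else 0 := fun i => by
    by_cases h : i ∈ K <;> simp [shiftOn, h]
  simp [this, sum_add_distrib]

include hodd hent hnz hW in
lemma sum_cauchyProd_shiftOn {n : ℕ} (c : ℂ) (x w : Fin n → ℂ) (s : ℕ)
    (h0 : ∀ i j, br (x i - w j) ≠ 0) (h1 : ∀ i j, br (x i - w j + c) ≠ 0) :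
    ∑ K ∈ powersetCard s univ, cauchyProd br (shiftOn c K x) w
      = ∑ K ∈ powersetCard s univ, cauchyProd br x (shiftOn (-c) K w) := by
  obtain ⟨t, ht⟩ := (dense_forall_br_add_ne_zero hent hnz
    (fun b : Bool => if b then 0 else ∑ i, (x i - w i) + s * c)).nonempty
  have ht0 : br t ≠ 0 := by simpa using ht true
  have ht1 : br (t + (∑ i, (x i - w i) + s * c)) ≠ 0 := by simpa using ht false
  have key := congrArg (br t * ·) (sum_det_mix_rows_eq_cols (frobMatrix br t x w)
    (frobMatrix br t (fun i => x i + c) w) s)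
  simp only [← frobMatrix_shiftOn, ← frobMatrix_shiftOn_right, mul_sum] at key
  have hl : ∀ K ∈ powersetCard s (univ : Finset (Fin n)),
      br t * (frobMatrix br t (shiftOn c K x) w).det
        = (br t ^ n * br (t + (∑ i, (x i - w i) + s * c))) * cauchyProd br (shiftOn c K x) w := by
    intro K hK
    rw [br_mul_det_frobMatrix hodd hent hnz hW]
    · rw [sum_sub_distrib, sum_shiftOn, (mem_powersetCard.mp hK).2, sum_sub_distrib]
      congr 4
      ring
    · intro i j
      by_cases hi : i ∈ K
      · simpa [shiftOn, hi, add_sub_right_comm] using h1 i j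
      · simpa [shiftOn, hi] using h0 i j
  have hr : ∀ K ∈ powersetCard s (univ : Finset (Fin n)),
      br t * (frobMatrix br t x (shiftOn (-c) K w)).det
        = (br t ^ n * br (t + (∑ i, (x i - w i) + s * c)))
          * cauchyProd br x (shiftOn (-c) K w) := by
    intro K hK
    rw [br_mul_det_frobMatrix hodd hent hnz hW]
    · rw [sum_sub_distrib, sum_shiftOn, (mem_powersetCard.mp hK).2, sum_sub_distrib]
      congr 4
      ring
    · intro i j
      by_cases hj : j ∈ K
      · have := h1 i j
        rw [sub_add] at this
        simpa [shiftOn, hj, ← sub_eq_add_neg] using this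
      · simpa [shiftOn, hj] using h0 i j
  rw [sum_congr rfl hl, sum_congr rfl hr, ← mul_sum, ← mul_sum] at key
  exact mul_left_cancel₀ (mul_ne_zero (pow_ne_zero _ ht0) ht1) key

include hodd hent hnz hW in
lemma sum_dualTerm_fin_of_ne {n : ℕ} (c : ℂ) (x w : Fin n → ℂ) (s : ℕ)
    (hx : ∀ i j, i ≠ j → br (x i - x j) ≠ 0) (hw : ∀ i j, i ≠ j → br (w i - w j) ≠ 0)
    (h0 : ∀ i j, br (x i - w j) ≠ 0) (h1 : ∀ i j, br (x i - w j + c) ≠ 0) :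
    ∑ K ∈ powersetCard s univ, dualTerm br c x w K
      = ∑ K ∈ powersetCard s univ, dualTerm br c (-w) (-x) K := by
  have hC : cauchyProd br x w ≠ 0 := by
    refine div_ne_zero ?_ (prod_ne_zero_iff.mpr fun i _ => prod_ne_zero_iff.mpr fun j _ => h0 i j)
    refine prod_ne_zero_iff.mpr fun i _ => prod_ne_zero_iff.mpr fun j _ => ?_
    split_ifs with hij
    · exact mul_ne_zero (hx _ _ hij.ne) (hw _ _ hij.ne')
    · exact one_ne_zero
  refine mul_right_cancel₀ hC ?_
  rw [sum_mul, sum_mul]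
  have hr : ∀ K : Finset (Fin n), dualTerm br c (-w) (-x) K * cauchyProd br x w
      = (∏ i, ∏ j, br (x i - w j + c)) * cauchyProd br x (shiftOn (-c) K w) := by
    intro K
    rw [← cauchyProd_neg_neg x w, dualTerm_mul_cauchyProd hodd, ← cauchyProd_neg_neg x]
    · congr 1
      · rw [prod_comm]
        simp only [Pi.neg_apply, neg_sub_neg]
      · congr 1
        ext i
        by_cases hi : i ∈ K <;> simp [shiftOn, hi, add_comm]
    · intro i j hij
      simpa only [Pi.neg_apply, neg_sub_neg] using hw j i hij.symm
    · intro i j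
      simpa only [Pi.neg_apply, neg_sub_neg] using h0 j i
    · intro i j
      simpa only [Pi.neg_apply, neg_sub_neg] using h1 j i
  simp only [hr, dualTerm_mul_cauchyProd hodd c x w _ hx h0 h1, ← mul_sum]
  rw [sum_cauchyProd_shiftOn hodd hent hnz hW c x w s h0 h1]

lemma dualTerm_comp_equiv {N N' : Type*} [Fintype N] [DecidableEq N] [Fintype N'] [DecidableEq N']
    (e : N ≃ N') (c : ℂ) (x w : N' → ℂ) (K : Finset N) :
    dualTerm br c (x ∘ e) (w ∘ e) K = dualTerm br c x w (e.finsetCongr K) := by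
  unfold dualTerm
  rw [← e.prod_comp]
  refine prod_congr rfl fun i _ => ?_
  rw [← e.prod_comp]
  simp [Equiv.finsetCongr_apply]

lemma continuous_dualTerm (hbr : Continuous br) {N E : Type*} [Fintype N] [DecidableEq N]
    [TopologicalSpace E] (c : ℂ) (x w : E → N → ℂ) (hx : Continuous x) (hw : Continuous w)
    (K : Finset N) (hd : ∀ i j p, i ≠ j → br (x p i - x p j) ≠ 0) :
    Continuous fun p => dualTerm br c (x p) (w p) K := by
  unfold dualTerm
  refine continuous_finsetProd _ fun i _ => continuous_finsetProd _ fun j _ => ?_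
  refine Continuous.mul ?_ ?_
  · split_ifs with h
    · have hij : i ≠ j := fun e => h.2 (e ▸ h.1)
      refine Continuous.div (by fun_prop) (by fun_prop) fun p => hd i j p hij
    · exact continuous_const
  · split_ifs <;> fun_prop

include hodd hent hnz hW in
/-- The duality transformation for sums over subsets of fixed cardinality. -/
theorem sum_dualTerm {N : Type*} [Fintype N] [DecidableEq N] (c : ℂ) (x w : N → ℂ) (s : ℕ)
    (hx : ∀ i j, i ≠ j → br (x i - x j) ≠ 0) (hw : ∀ i j, i ≠ j → br (w i - w j) ≠ 0) :
    ∑ K ∈ powersetCard s univ, dualTerm br c x w K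
      = ∑ K ∈ powersetCard s univ, dualTerm br c (-w) (-x) K := by
  have hfin : ∀ x' w' : Fin (Fintype.card N) → ℂ, (∀ i j, i ≠ j → br (x' i - x' j) ≠ 0) →
      (∀ i j, i ≠ j → br (w' i - w' j) ≠ 0) →
      ∑ K ∈ powersetCard s univ, dualTerm br c x' w' K
      = ∑ K ∈ powersetCard s univ, dualTerm br c (-w') (-x') K := by
    intro x' w' hx' hw'
    have hS := dense_forall_br_add_ne_zero hent hnz
      (fun q : (Fin (Fintype.card N) × Fin (Fintype.card N)) × Bool =>
        x' q.1.1 - w' q.1.2 + if q.2 then c else 0)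
    have := eq_of_dense_of_continuousAt hS (p := 0)
      (f := fun ε => ∑ K ∈ powersetCard s univ, dualTerm br c (fun i => ε + x' i) w' K)
      (g := fun ε => ∑ K ∈ powersetCard s univ, dualTerm br c (-w') (-(fun i => ε + x' i)) K)
      (Continuous.continuousAt (continuous_finsetSum _ fun K _ =>
        continuous_dualTerm hent.continuous c (fun ε i => ε + x' i) (fun _ => w') (by fun_prop)
          (by fun_prop) K fun i j p hij => by simpa using hx' i j hij))
      (Continuous.continuousAt (continuous_finsetSum _ fun K _ =>
        continuous_dualTerm hent.continuous c (fun _ => -w') (fun ε => -(fun i => ε + x' i))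
          (by fun_prop) (by fun_prop) K fun i j p hij => by
            simpa only [Pi.neg_apply, neg_sub_neg] using hw' j i hij.symm))
      (fun ε hε => sum_dualTerm_fin_of_ne hodd hent hnz hW c _ _ s
        (fun i j hij => by simpa using hx' i j hij) hw'
        (fun i j => by simpa [add_sub_assoc] using hε ((i, j), false))
        (fun i j => by simpa [add_sub_assoc, add_assoc] using hε ((i, j), true)))
    simpa using this
  let e := (Fintype.equivFin N).symm
  have h := hfin (x ∘ e) (w ∘ e) (fun i j hij => hx _ _ (by simpa using hij))
    (fun i j hij => hw _ _ (by simpa using hij))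
  have hn : ∀ v : N → ℂ, -(v ∘ e) = (-v) ∘ e := fun v => rfl
  simp only [hn, dualTerm_comp_equiv] at h
  have hre : ∀ f : Finset N → ℂ, ∑ K ∈ powersetCard s univ, f (e.finsetCongr K)
      = ∑ K ∈ powersetCard s univ, f K := fun f =>
    sum_equiv e.finsetCongr (fun K => by simp [mem_powersetCard]) fun K _ => rfl
  rw [hre (dualTerm br c x w), hre (dualTerm br c (-w) (-x))] at h
  exact h

end Duality

section ShiftedProducts

/-- The shifted factorial `[x; a]_n` for a natural number `n`. -/
noncomputable def bracketProd (br : ℂ → ℂ) (a x : ℂ) (n : ℕ) : ℂ :=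
  ∏ i ∈ range n, br (x + (i : ℂ) * a)

variable {br : ℂ → ℂ}

lemma sfac_natCast (a x : ℂ) (n : ℕ) : sfac br a x (n : ℤ) = bracketProd br a x n := by
  simp [sfac, bracketProd]

lemma bracketProd_succ (a x : ℂ) (n : ℕ) :
    bracketProd br a x (n + 1) = bracketProd br a x n * br (x + n * a) := by
  simp [bracketProd, prod_range_succ]

lemma bracketProd_succ' (a x : ℂ) (n : ℕ) :
    bracketProd br a x (n + 1) = br x * bracketProd br a (x + a) n := by
  rw [bracketProd, prod_range_succ', mul_comm]
  simp only [Nat.cast_zero, zero_mul, add_zero, bracketProd]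
  congr 1
  refine prod_congr rfl fun i _ => ?_
  push_cast
  ring_nf

lemma bracketProd_add_mul (a x : ℂ) (n : ℕ) :
    bracketProd br a (x + a) n * br x = bracketProd br a x n * br (x + n * a) := by
  rw [mul_comm, ← bracketProd_succ', bracketProd_succ]

end ShiftedProducts

section Coefficients

variable {br : ℂ → ℂ} {m r : ℕ}

/-- Factor of `Coef` attached to an ordered pair of `x`-variables. -/
noncomputable def selfFactor (br : ℂ → ℂ) (a b : ℂ) (μ : Fin m → ℕ) (x : Fin m → ℂ)
    (i j : Fin m) : ℂ :=
  (if i < j then br (x i - x j + ((μ i : ℂ) - (μ j : ℂ)) * a) / br (x i - x j) else 1)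
    * (bracketProd br a (x i - x j + b) (μ i) / bracketProd br a (x i - x j + a) (μ i))

/-- Factor of `Coef` attached to an ordered pair of `y`-variables. -/
noncomputable def cutFactor (br : ℂ → ℂ) (a : ℂ) (I : Finset (Fin r)) (y : Fin r → ℂ)
    (i j : Fin r) : ℂ :=
  if i ∈ I ∧ j ∉ I then br (y i - y j - a) / br (y i - y j) else 1

/-- Factor of `Coef` attached to an `x`-variable and a `y`-variable. -/
noncomputable def mixFactor (br : ℂ → ℂ) (a b : ℂ) (μ : Fin m → ℕ) (I : Finset (Fin r))
    (x : Fin m → ℂ) (y : Fin r → ℂ) (i : Fin m) (j : Fin r) : ℂ :=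
  if j ∈ I then br (x i - y j - b) / br (x i - y j + (μ i : ℂ) * a)
  else br (x i - y j - a) / br (x i - y j + ((μ i : ℂ) - 1) * a)

lemma Coef_eq (a b : ℂ) (μ : Fin m → ℕ) (I : Finset (Fin r)) (x : Fin m → ℂ) (y : Fin r → ℂ) :
    Coef br a b μ I x y = (-1 : ℂ) ^ I.card * (∏ i, ∏ j, selfFactor br a b μ x i j)
      * (∏ i, ∏ j, cutFactor br a I y i j) * ∏ i, ∏ j, mixFactor br a b μ I x y i j := by
  have hcut : ∏ i ∈ I, ∏ j ∈ Iᶜ, br (y i - y j - a) / br (y i - y j)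
      = ∏ i, ∏ j, cutFactor br a I y i j := by
    rw [← prod_filter_mul_prod_filter_not univ (· ∈ I)]
    rw [prod_eq_one (s := univ.filter fun i => ¬ i ∈ I), mul_one, filter_mem_eq_inter, univ_inter]
    · refine prod_congr rfl fun i hi => ?_
      rw [compl_eq_univ_sdiff, sdiff_eq_filter, prod_filter]
      refine prod_congr rfl fun j _ => ?_
      simp [cutFactor, hi]
    · intro i hi
      simp only [mem_filter, mem_univ, true_and] at hi
      simp [cutFactor, hi]
  have hmix : ∀ i : Fin m, (∏ j ∈ I, br (x i - y j - b) / br (x i - y j + (μ i : ℂ) * a))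
          * ∏ j ∈ Iᶜ, br (x i - y j - a) / br (x i - y j + ((μ i : ℂ) - 1) * a)
      = ∏ j, mixFactor br a b μ I x y i j := by
    intro i
    simp only [mixFactor]
    rw [prod_ite, filter_mem_eq_inter, univ_inter, compl_eq_univ_sdiff, sdiff_eq_filter]
  simp only [Coef, hcut, hmix, sfac_natCast, selfFactor, prod_mul_distrib]
  ring

/-- Genericity: no integer combination of the variables and of `δ`, `κ` that can occur is a zero
of the bracket. -/
structure IsGeneric (br : ℂ → ℂ) (δ κ : ℂ) (x : Fin m → ℂ) (y : Fin r → ℂ) : Prop where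
  xx : ∀ i j, i ≠ j → ∀ n k : ℤ, br (x i - x j + n * δ + k * κ) ≠ 0
  yy : ∀ i j, i ≠ j → ∀ n k : ℤ, br (y i - y j + n * δ + k * κ) ≠ 0
  xy : ∀ i j, ∀ n k : ℤ, br (x i - y j + n * δ + k * κ) ≠ 0
  params : ∀ n k : ℤ, (n ≠ 0 ∨ k ≠ 0) → br (n * δ + k * κ) ≠ 0

lemma IsGeneric.swap (hodd : ∀ z : ℂ, br (-z) = -br z) {δ κ : ℂ} {x : Fin m → ℂ}
    {y : Fin r → ℂ} (h : IsGeneric br δ κ x y) : IsGeneric br (-κ) (-δ) y x where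
  xx i j hij n k := by
    have := h.yy i j hij (-k) (-n)
    push_cast at this
    convert this using 2
    ring
  yy i j hij n k := by
    have := h.xx i j hij (-k) (-n)
    push_cast at this
    convert this using 2
    ring
  xy i j n k := by
    have := h.xy j i k n
    rw [← neg_ne_zero, ← hodd]  at this
    convert this using 2
    ring
  params n k hnk := by
    have := h.params (-k) (-n) (by omega)
    push_cast at this
    convert this using 2
    ring

/-- Common factor attached to an ordered pair of variables of the same kind. -/
noncomputable def commonSelf (br : ℂ → ℂ) (δ κ : ℂ) (l : Fin m → ℕ) (x : Fin m → ℂ)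
    (i j : Fin m) : ℂ :=
  selfFactor br δ κ l x i j / br (x i - (x j + l j * δ) + (δ - κ))

/-- Common factor attached to a pair of variables of different kinds. -/
noncomputable def commonMix (br : ℂ → ℂ) (δ κ : ℂ) (l : Fin m → ℕ) (p : Fin r → ℕ)
    (x : Fin m → ℂ) (y : Fin r → ℂ) (i : Fin m) (j : Fin r) : ℂ :=
  -1 / (br (x i - y j + l i * δ + (p j - 1) * κ) * br (x i - y j + (l i - 1) * δ + p j * κ))

variable (hodd : ∀ z : ℂ, br (-z) = -br z)

lemma ne_zero_of_eq {u v : ℂ} (h : br u ≠ 0) (e : v = u) : br v ≠ 0 := e ▸ h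

lemma bracketProd_ratio_succ {z δ κ : ℂ} {n : ℕ} (h1 : br (z + κ + n * δ) ≠ 0)
    (h2 : br (z + δ + n * δ) ≠ 0) :
    bracketProd br δ (z + κ) n / bracketProd br δ (z + δ) n
      = bracketProd br δ (z + κ) (n + 1) / bracketProd br δ (z + δ) (n + 1)
        * (br (z + δ + n * δ) / br (z + κ + n * δ)) := by
  rw [bracketProd_succ, bracketProd_succ, div_mul_div_comm,
    mul_right_comm, mul_assoc (bracketProd br δ (z + δ) n), mul_comm (br (z + δ + n * δ)),
    mul_assoc (bracketProd br δ (z + κ) n), mul_comm (br (z + δ + n * δ)),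
    mul_div_mul_right _ _ (mul_ne_zero h1 h2)]

lemma bracketProd_ratio_shift_succ {z δ κ : ℂ} {n : ℕ} (h1 : br (z + κ) ≠ 0)
    (h2 : br (z + δ) ≠ 0) :
    br (z + κ) / br z * (bracketProd br δ (z + κ + δ) n / bracketProd br δ (z + δ + δ) n)
      = bracketProd br δ (z + κ) (n + 1) / bracketProd br δ (z + δ) (n + 1)
        * (br (z + δ) / br z) := by
  rw [bracketProd_succ', bracketProd_succ']
  field_simp

lemma bracketProd_ratio_shift {z δ κ : ℂ} {n : ℕ} (h0 : br z ≠ 0)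
    (h1 : br (z + κ - δ + n * δ) ≠ 0) (h2 : br (z + n * δ) ≠ 0) :
    bracketProd br δ (z + κ - δ) n / bracketProd br δ z n
      = bracketProd br δ (z + κ) n / bracketProd br δ (z + δ) n
        * (br (z + n * δ) / br (z + κ - δ + n * δ)) * (br (z + κ - δ) / br z) := by
  have e1 := bracketProd_add_mul (br := br) δ (z + κ - δ) n
  have e2 := bracketProd_add_mul (br := br) δ z n
  rw [sub_add_cancel] at e1
  have e1' := eq_div_of_mul_eq h1 e1.symm
  have e2' := eq_div_of_mul_eq h2 e2.symm
  rw [e1', e2']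
  generalize br (z + κ - δ + n * δ) = A at *
  generalize br (z + n * δ) = B at *
  generalize br z = C at *
  field_simp

/-- The part of the factor of an ordered pair that is not shared by all subsets. -/
noncomputable def cutRatio (br : ℂ → ℂ) (δ κ : ℂ) (J : Finset (Fin m)) (x : Fin m → ℂ)
    (i j : Fin m) : ℂ :=
  if i ∈ J then (if j ∈ J then 1 else br (x i - x j + δ) / br (x i - x j))
  else (if j ∈ J then br (x i - x j + κ - δ) / br (x i - x j) else 1)

include hodd in
lemma cutFactor_mul_ratio {δ κ : ℂ} {x : Fin m → ℂ} {y : Fin r → ℂ} (h : IsGeneric br δ κ x y)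
    (J : Finset (Fin m)) (μ l : Fin m → ℕ) (hl : ∀ i, l i = μ i + if i ∈ J then 1 else 0)
    (i j : Fin m) :
    cutFactor br (-κ) J x i j
        * (bracketProd br δ (xshiftI δ J x i - xshiftI δ J x j + κ) (μ i)
          / bracketProd br δ (xshiftI δ J x i - xshiftI δ J x j + δ) (μ i))
      = bracketProd br δ (x i - x j + κ) (l i) / bracketProd br δ (x i - x j + δ) (l i)
        * ((if j ∈ J then br (x j - (x i + l i * δ)) else br (x j - (x i + l i * δ) + (δ - κ)))
          / br (x j - (x i + l i * δ) + (δ - κ))) * cutRatio br δ κ J x i j := by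
  have hgen : ∀ n k : ℤ, (n ≠ 0 ∨ k ≠ 0) → br (x i - x j + n * δ + k * κ) ≠ 0 := by
    intro n k hnk
    by_cases hij : i = j
    · simpa [hij] using h.params n k hnk
    · exact h.xx i j hij n k
  have hneg : ∀ u v : ℂ, v = -u → br v = -br u := fun u v e => by rw [e, hodd]
  by_cases hi : i ∈ J <;> by_cases hj : j ∈ J
  · have hli : l i = μ i + 1 := by simp [hl, hi]
    have a1 : br (x i - x j + κ + μ i * δ) ≠ 0 :=
      ne_zero_of_eq (hgen (μ i) 1 (by simp)) (by push_cast; ring)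
    have a2 : br (x i - x j + δ + μ i * δ) ≠ 0 :=
      ne_zero_of_eq (hgen (μ i + 1) 0 (by omega)) (by push_cast; ring)
    have key := bracketProd_ratio_succ a1 a2
    have e1 := hneg (x i - x j + δ + μ i * δ) (x j - (x i + ((μ i + 1 : ℕ) : ℂ) * δ))
      (by push_cast; ring)
    have e2 := hneg (x i - x j + κ + μ i * δ) (x j - (x i + ((μ i + 1 : ℕ) : ℂ) * δ) + (δ - κ))
      (by push_cast; ring)
    simp only [cutFactor, cutRatio, xshiftI, hi, hj, if_true, not_true, and_false, if_false, hli,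
      add_sub_add_right_eq_sub, one_mul, mul_one, e1, e2, neg_div_neg_eq]
    exact key
  · have hij : i ≠ j := fun e => hj (e ▸ hi)
    have hli : l i = μ i + 1 := by simp [hl, hi]
    have a1 : br (x i - x j + κ) ≠ 0 := ne_zero_of_eq (hgen 0 1 (by simp)) (by push_cast; ring)
    have a2 : br (x i - x j + δ) ≠ 0 := ne_zero_of_eq (hgen 1 0 (by simp)) (by push_cast; ring)
    have a3 : br (x j - (x i + ((μ i + 1 : ℕ) : ℂ) * δ) + (δ - κ)) ≠ 0 := by
      rw [hneg (x i - x j + κ + μ i * δ) _ (by push_cast; ring), neg_ne_zero]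
      exact ne_zero_of_eq (hgen (μ i) 1 (by simp)) (by push_cast; ring)
    have key := bracketProd_ratio_shift_succ (n := μ i) a1 a2
    simp only [cutFactor, cutRatio, xshiftI, hi, hj, if_true, not_false_iff, and_self, if_false,
      hli, mul_one, mul_zero, add_zero, div_self a3, sub_neg_eq_add]
    rw [← key]
    congr 3 <;> ring
  · have hij : i ≠ j := fun e => hi (e ▸ hj)
    have hli : l i = μ i := by simp [hl, hi]
    have a0 : br (x i - x j) ≠ 0 := ne_zero_of_eq (h.xx i j hij 0 0) (by push_cast; ring)
    have a1 : br (x i - x j + κ - δ + μ i * δ) ≠ 0 :=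
      ne_zero_of_eq (hgen (μ i - 1) 1 (by simp)) (by push_cast; ring)
    have a2 : br (x i - x j + μ i * δ) ≠ 0 :=
      ne_zero_of_eq (h.xx i j hij (μ i) 0) (by push_cast; ring)
    have key := bracketProd_ratio_shift a0 a1 a2
    have e1 := hneg (x i - x j + μ i * δ) (x j - (x i + (μ i : ℂ) * δ)) (by ring)
    have e2 := hneg (x i - x j + κ - δ + μ i * δ) (x j - (x i + (μ i : ℂ) * δ) + (δ - κ))
      (by ring)
    simp only [cutFactor, cutRatio, xshiftI, hi, hj, if_true, false_and, if_false, hli, one_mul,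
      mul_one, mul_zero, add_zero, e1, e2, neg_div_neg_eq]
    rw [← key]
    congr 2 <;> ring
  · have hli : l i = μ i := by simp [hl, hi]
    have a3 : br (x j - (x i + (μ i : ℂ) * δ) + (δ - κ)) ≠ 0 := by
      rw [hneg (x i - x j + (μ i - 1) * δ + κ) _ (by ring), neg_ne_zero]
      exact ne_zero_of_eq (hgen (μ i - 1) 1 (by simp)) (by push_cast; ring)
    simp only [cutFactor, cutRatio, xshiftI, hi, hj, false_and, if_false, hli, one_mul, mul_one,
      mul_zero, add_zero, div_self a3]

include hodd in
lemma prod_xx_eq {δ κ : ℂ} {x : Fin m → ℂ} {y : Fin r → ℂ} (h : IsGeneric br δ κ x y)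
    (J : Finset (Fin m)) (μ l : Fin m → ℕ) (hl : ∀ i, l i = μ i + if i ∈ J then 1 else 0) :
    ∏ i, ∏ j, cutFactor br (-κ) J x i j * selfFactor br δ κ μ (xshiftI δ J x) i j
      = ∏ i, ∏ j, commonSelf br δ κ l x i j *
        ((if i ∈ J ∧ j ∉ J then br (x i - x j + (δ - κ)) / br (x i - x j) else 1)
          * (if i ∈ J then br (x i - (x j + l j * δ))
              else br (x i - (x j + l j * δ) + (δ - κ)))) := by
  have hself : ∀ i j, cutFactor br (-κ) J x i j * selfFactor br δ κ μ (xshiftI δ J x) i j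
      = (if i < j then br (x i - x j + ((l i : ℂ) - l j) * δ)
            / br (xshiftI δ J x i - xshiftI δ J x j) else 1)
        * (bracketProd br δ (x i - x j + κ) (l i) / bracketProd br δ (x i - x j + δ) (l i)
        * ((if j ∈ J then br (x j - (x i + l i * δ)) else br (x j - (x i + l i * δ) + (δ - κ)))
          / br (x j - (x i + l i * δ) + (δ - κ))) * cutRatio br δ κ J x i j) := by
    intro i j
    rw [← cutFactor_mul_ratio hodd h J μ l hl, selfFactor, mul_left_comm]
    congr 4
    simp only [xshiftI, hl]
    push_cast
    ring_nf
  simp only [hself]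
  refine prod_prod_eq_of_pairs _ _ (fun i => ?_) (fun i j hij => ?_)
  · by_cases hi : i ∈ J <;>
    simp only [commonSelf, selfFactor, cutRatio, hi, lt_self_iff_false, if_false, if_true,
      not_true, and_false, false_and] <;> ring
  · have a0 : br (x i - x j) ≠ 0 := ne_zero_of_eq (h.xx i j hij.ne 0 0) (by push_cast; ring)
    have a1 : br (x i - x j + δ) ≠ 0 := ne_zero_of_eq (h.xx i j hij.ne 1 0) (by push_cast; ring)
    have a2 : br (x i - x j - δ) ≠ 0 :=
      ne_zero_of_eq (h.xx i j hij.ne (-1) 0) (by push_cast; ring)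
    have hneg : ∀ u v : ℂ, v = -u → br v = -br u := fun u v e => by rw [e, hodd]
    have e0 := hneg (x i - x j) (x j - x i) (by ring)
    have e1 := hneg (x i - x j - δ) (x j - x i + δ) (by ring)
    have e2 := hneg (x i - x j + (δ - κ)) (x j - x i + κ - δ) (by ring)
    have e3 := hneg (x i - x j + κ - δ) (x j - x i + (δ - κ)) (by ring)
    have e4 : x i + δ - x j = x i - x j + δ := by ring
    have e5 : x i - (x j + δ) = x i - x j - δ := by ring
    have habs : ∀ N D b R R' S S' E E' c c' a a' : ℂ, c * c' / D = a * a' / b →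
        N / D * (R * (S / E) * c) * (1 * (R' * (S' / E') * c'))
          = N / b * R / E' * (a * S') * (1 * R' / E * (a' * S)) := by
      intro N D b R R' S S' E E' c c' a a' hc
      linear_combination N * R * S / E * R' * S' / E' * hc
    simp only [commonSelf, selfFactor, hij, hij.not_gt, if_true, if_false]
    refine habs _ _ _ _ _ _ _ _ _ _ _ _ _ ?_
    clear habs
    by_cases hi : i ∈ J <;> by_cases hj : j ∈ J
    · simp only [cutRatio, xshiftI, hi, hj, if_true, if_false, not_true, and_false,
        add_sub_add_right_eq_sub]
    · simp only [cutRatio, xshiftI, hi, hj, if_true, if_false, not_false_iff, and_self,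
        false_and, mul_one, mul_zero, add_zero, e4, e0, e2]
      generalize br (x i - x j + δ) = A at *
      generalize br (x i - x j) = B at *
      field_simp
    · simp only [cutRatio, xshiftI, hi, hj, if_true, if_false, not_false_iff, and_self,
        false_and, mul_one, mul_zero, add_zero, e5, e0, e1, e3]
      generalize br (x i - x j - δ) = A at *
      generalize br (x i - x j) = B at *
      field_simp
    · simp only [cutRatio, xshiftI, hi, hj, if_false, false_and, mul_zero, add_zero]

include hodd in
lemma prod_yy_eq {δ κ : ℂ} {x : Fin m → ℂ} {y : Fin r → ℂ} (h : IsGeneric br δ κ x y)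
    (I : Finset (Fin r)) (ν p : Fin r → ℕ) (hp : ∀ i, p i = ν i + if i ∈ I then 1 else 0) :
    ∏ i, ∏ j, selfFactor br (-κ) (-δ) ν y i j * cutFactor br δ I (yshiftMu κ ν y) i j
      = (-1) ^ (r * r) * ∏ i, ∏ j, commonSelf br (-κ) (-δ) p y i j *
        ((if i ∉ I ∧ j ∈ I then br (y i - (p i - 1) * κ - (y j - (p j - 1) * κ) + (δ - κ))
              / br (y i - (p i - 1) * κ - (y j - (p j - 1) * κ)) else 1)
          * (if i ∉ I then br (y i - (p i - 1) * κ - (y j + δ))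
              else br (y i - (p i - 1) * κ - (y j + δ) + (δ - κ)))) := by
  have hneg : ∀ u v : ℂ, v = -u → br v = -br u := fun u v e => by rw [e, hodd]
  have hgen : ∀ i j, ∀ n k : ℤ, (n ≠ 0 ∨ k ≠ 0) → br (y i - y j + n * δ + k * κ) ≠ 0 := by
    intro i j n k hnk
    by_cases hij : i = j
    · simpa [hij] using h.params n k hnk
    · exact h.yy i j hij n k
  have hratio : ∀ i j, bracketProd br (-κ) (y i - y j + -δ) (ν i)
        / bracketProd br (-κ) (y i - y j + -κ) (ν i)
      = bracketProd br (-κ) (y i - y j + -δ) (p i) / bracketProd br (-κ) (y i - y j + -κ) (p i)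
        * ((if i ∉ I then br (y i - (p i - 1) * κ - (y j + δ))
              else br (y i - (p i - 1) * κ - (y j + δ) + (δ - κ)))
          / br (y i - (p i - 1) * κ - (y j + δ))) := by
    intro i j
    by_cases hi : i ∈ I
    · have hpi : p i = ν i + 1 := by simp [hp, hi]
      have key := bracketProd_ratio_succ (br := br) (z := y i - y j) (δ := -κ) (κ := -δ) (n := ν i)
        (ne_zero_of_eq (hgen i j (-1) (-ν i) (by simp)) (by push_cast; ring))
        (ne_zero_of_eq (hgen i j 0 (-ν i - 1) (by omega)) (by push_cast; ring))
      rw [key]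
      simp only [hpi, hi, not_true, if_false]
      congr 3 <;> push_cast <;> ring
    · have hpi : p i = ν i := by simp [hp, hi]
      have a : br (y i - ((ν i : ℂ) - 1) * κ - (y j + δ)) ≠ 0 :=
        ne_zero_of_eq (hgen i j (-1) (-ν i + 1) (by simp)) (by push_cast; ring)
      simp only [hpi, hi, not_false_iff, if_true, div_self a, mul_one]
  have hself : ∀ i j, selfFactor br (-κ) (-δ) ν y i j * cutFactor br δ I (yshiftMu κ ν y) i j
      = ((if i < j then br (y i - y j + ((ν i : ℂ) - ν j) * (-κ)) / br (y i - y j) else 1)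
          * cutFactor br δ I (yshiftMu κ ν y) i j)
        * (bracketProd br (-κ) (y i - y j + -δ) (p i) / bracketProd br (-κ) (y i - y j + -κ) (p i)
        * ((if i ∉ I then br (y i - (p i - 1) * κ - (y j + δ))
              else br (y i - (p i - 1) * κ - (y j + δ) + (δ - κ)))
          / br (y i - (p i - 1) * κ - (y j + δ)))) := by
    intro i j
    rw [← hratio, selfFactor]
    ring
  have hsign : (-1 : ℂ) ^ (r * r) = ∏ _i : Fin r, ∏ _j : Fin r, (-1 : ℂ) := by
    simp [pow_mul]
  rw [hsign]
  simp only [hself, ← prod_mul_distrib]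
  have hden : ∀ i j : Fin r, br (y i - (y j + p j * -κ) + (-κ - -δ))
      = - br (y j - (p j - 1) * κ - (y i + δ)) := fun i j => hneg _ _ (by ring)
  refine prod_prod_eq_of_pairs _ _ (fun i => ?_) (fun i j hij => ?_)
  · by_cases hi : i ∈ I <;>
    simp only [commonSelf, selfFactor, cutFactor, hi, lt_self_iff_false, if_false, if_true,
      not_true, not_false_iff, and_false, false_and, hden] <;> ring
  · have a0 : br (y i - y j) ≠ 0 := ne_zero_of_eq (h.yy i j hij.ne 0 0) (by push_cast; ring)
    have a1 : br (y i - y j + ((ν i : ℂ) - ν j) * (-κ)) ≠ 0 :=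
      ne_zero_of_eq (h.yy i j hij.ne 0 (ν j - ν i)) (by push_cast; ring)
    have a2 : br (y i - y j + ((p i : ℂ) - p j) * (-κ)) ≠ 0 :=
      ne_zero_of_eq (h.yy i j hij.ne 0 (p j - p i)) (by push_cast; ring)
    have e1 : yshiftMu κ ν y i - yshiftMu κ ν y j = y i - y j + ((ν i : ℂ) - ν j) * (-κ) := by
      simp only [yshiftMu]; ring
    have e2 := hneg (y i - y j + ((ν i : ℂ) - ν j) * (-κ)) (yshiftMu κ ν y j - yshiftMu κ ν y i)
      (by simp only [yshiftMu]; ring)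
    have e3 : y i - (p i - 1) * κ - (y j - (p j - 1) * κ)
      = y i - y j + ((p i : ℂ) - p j) * (-κ) := by ring
    have e4 := hneg (y i - y j + ((p i : ℂ) - p j) * (-κ))
      (y j - (p j - 1) * κ - (y i - (p i - 1) * κ)) (by ring)
    have habs : ∀ N N' b R R' S S' E E' c c' a a' : ℂ, N * (c * c') = N' * (a * a') →
        N / b * c * (R * (S / E)) * (1 * c' * (R' * (S' / E')))
          = -1 * (N' / b * R / (-E') * (a * S)) * (-1 * (1 * R' / (-E) * (a' * S'))) := by
      intro N N' b R R' S S' E E' c c' a a' hc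
      simp only [div_neg]
      linear_combination 1 / b * R * S / E * R' * S' / E' * hc
    simp only [commonSelf, selfFactor, hij, hij.not_gt, if_true, if_false, hden]
    refine habs _ _ _ _ _ _ _ _ _ _ _ _ _ ?_
    clear habs hself hratio hden hsign
    have hpi := hp i
    have hpj := hp j
    by_cases hi : i ∈ I <;> by_cases hj : j ∈ I
    · have e5 : ((p i : ℂ) - p j) = (ν i : ℂ) - ν j := by
        simp [hpi, hpj, hi, hj]
      simp only [cutFactor, hi, hj, not_true, and_false, false_and, if_false, e5]
    · have e6 := hneg (y i - y j + ((ν i : ℂ) - ν j) * (-κ) - δ)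
        (y j - (p j - 1) * κ - (y i - (p i - 1) * κ) + (δ - κ))
        (by simp [hpi, hpj, hi, hj]; ring)
      simp only [cutFactor, hi, hj, if_false, if_true, not_true, not_false_iff, and_self,
        mul_one, one_mul, e1, e4, e6]
      generalize br (y i - y j + ((ν i : ℂ) - ν j) * (-κ)) = A at *
      generalize br (y i - y j + ((p i : ℂ) - p j) * (-κ)) = B at *
      field_simp
    · have e6 := hneg (yshiftMu κ ν y j - yshiftMu κ ν y i - δ)
        (y i - y j + ((p i : ℂ) - p j) * (-κ) + (δ - κ))
        (by simp [hpi, hpj, hi, hj, yshiftMu]; ring)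
      simp only [cutFactor, hi, hj, if_false, if_true, not_true, not_false_iff, and_self,
        mul_one, one_mul, e2, e6, e3]
      generalize br (y i - y j + ((ν i : ℂ) - ν j) * (-κ)) = A at *
      generalize br (y i - y j + ((p i : ℂ) - p j) * (-κ)) = B at *
      field_simp
    · have e5 : ((p i : ℂ) - p j) = (ν i : ℂ) - ν j := by
        simp [hpi, hpj, hi, hj]
      simp only [cutFactor, hi, hj, and_false, false_and, if_false, e5]

include hodd in
lemma mixFactor_mul_mixFactor {δ κ : ℂ} {x : Fin m → ℂ} {y : Fin r → ℂ}
    (h : IsGeneric br δ κ x y)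
    (J : Finset (Fin m)) (μ l : Fin m → ℕ) (hl : ∀ i, l i = μ i + if i ∈ J then 1 else 0)
    (I : Finset (Fin r)) (ν p : Fin r → ℕ) (hp : ∀ i, p i = ν i + if i ∈ I then 1 else 0)
    (i : Fin m) (j : Fin r) :
    mixFactor br (-κ) (-δ) ν J y x j i
        * mixFactor br δ κ μ I (xshiftI δ J x) (yshiftMu κ ν y) i j
      = commonMix br δ κ l p x y i j
        * (((if i ∈ J ∧ j ∈ I then br (x i - (y j - (p j - 1) * κ) + (δ - κ))
              / br (x i - (y j - (p j - 1) * κ)) else 1)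
          * (if i ∈ J then br (x i - (y j + δ)) else br (x i - (y j + δ) + (δ - κ))))
        * ((if j ∉ I ∧ i ∉ J then br (y j - (p j - 1) * κ - x i + (δ - κ))
              / br (y j - (p j - 1) * κ - x i) else 1)
          * (if j ∉ I then br (y j - (p j - 1) * κ - (x i + l i * δ))
              else br (y j - (p j - 1) * κ - (x i + l i * δ) + (δ - κ))))) := by
  have hneg : ∀ u v : ℂ, v = -u → br v = -br u := fun u v e => by rw [e, hodd]
  have heq : ∀ u v : ℂ, v = u → br v = br u := fun u v e => by rw [e]
  have hz := h.xy i j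
  have b1 : br (x i - y j + l i * δ + (p j - 1) * κ) ≠ 0 :=
    ne_zero_of_eq (hz (l i) (p j - 1)) (by push_cast; ring)
  have b2 : br (x i - y j + (l i - 1) * δ + p j * κ) ≠ 0 :=
    ne_zero_of_eq (hz (l i - 1) (p j)) (by push_cast; ring)
  have b3 : br (x i - y j + (p j - 1) * κ) ≠ 0 :=
    ne_zero_of_eq (hz 0 (p j - 1)) (by push_cast; ring)
  have b4 : br (x i - y j + p j * κ) ≠ 0 :=
    ne_zero_of_eq (hz 0 (p j)) (by push_cast; ring)
  have b5 : br (x i - y j + (p j - 2) * κ) ≠ 0 :=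
    ne_zero_of_eq (hz 0 (p j - 2)) (by push_cast; ring)
  have c1 := heq (x i - y j + (p j - 2) * κ + δ) (x i - (y j - (p j - 1) * κ) + (δ - κ)) (by ring)
  have c2 := heq (x i - y j + (p j - 1) * κ) (x i - (y j - (p j - 1) * κ)) (by ring)
  have c3 := heq (x i - y j - δ) (x i - (y j + δ)) (by ring)
  have c4 := heq (x i - y j - κ) (x i - (y j + δ) + (δ - κ)) (by ring)
  have c5 := hneg (x i - y j + p j * κ - δ) (y j - (p j - 1) * κ - x i + (δ - κ)) (by ring)
  have c6 := hneg (x i - y j + (p j - 1) * κ) (y j - (p j - 1) * κ - x i) (by ring)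
  have c7 := hneg (x i - y j + l i * δ + (p j - 1) * κ)
    (y j - (p j - 1) * κ - (x i + l i * δ)) (by ring)
  have c8 := hneg (x i - y j + (l i - 1) * δ + p j * κ)
    (y j - (p j - 1) * κ - (x i + l i * δ) + (δ - κ)) (by ring)
  have d1 := hneg (x i - y j - δ) (y j - x i - -δ) (by ring)
  have d2 := hneg (x i - y j - κ) (y j - x i - -κ) (by ring)
  rw [c1, c2, c3, c4, c5, c6, c7, c8]
  by_cases hi : i ∈ J <;> by_cases hj : j ∈ I
  · have hli : (l i : ℂ) = μ i + 1 := by simp [hl, hi]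
    have hpj : (p j : ℂ) = ν j + 1 := by simp [hp, hj]
    have d3 := hneg (x i - y j + (p j - 1) * κ) (y j - x i + ν j * -κ) (by rw [hpj]; ring)
    have d4 := heq (x i - y j + (p j - 2) * κ + δ) (x i + δ * 1 - (y j - κ * ν j) - κ)
      (by rw [hpj]; ring)
    have d5 := heq (x i - y j + l i * δ + (p j - 1) * κ)
      (x i + δ * 1 - (y j - κ * ν j) + μ i * δ) (by rw [hpj, hli]; ring)
    simp only [mixFactor, commonMix, xshiftI, yshiftMu, hi, hj, if_true, not_true,
      if_false, and_self, d1, d3, d4, d5]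
    generalize br (x i - y j + l i * δ + (p j - 1) * κ) = B₁ at *
    generalize br (x i - y j + (l i - 1) * δ + p j * κ) = B₂ at *
    generalize br (x i - y j + (p j - 1) * κ) = B₃ at *
    generalize br (x i - y j + p j * κ) = B₄ at *
    generalize br (x i - y j + (p j - 2) * κ) = B₅ at *
    field_simp
  · have hli : (l i : ℂ) = μ i + 1 := by simp [hl, hi]
    have hpj : (p j : ℂ) = ν j := by simp [hp, hj]
    have d3 := hneg (x i - y j + p j * κ) (y j - x i + ν j * -κ) (by rw [hpj]; ring)
    have d4 := heq (x i - y j + p j * κ) (x i + δ * 1 - (y j - κ * ν j) - δ)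
      (by rw [hpj]; ring)
    have d5 := heq (x i - y j + (l i - 1) * δ + p j * κ)
      (x i + δ * 1 - (y j - κ * ν j) + (μ i - 1) * δ) (by rw [hpj, hli]; ring)
    simp only [mixFactor, commonMix, xshiftI, yshiftMu, hi, hj, if_true, not_true, and_false,
      if_false, not_false_iff, d1, d3, d4, d5]
    generalize br (x i - y j + l i * δ + (p j - 1) * κ) = B₁ at *
    generalize br (x i - y j + (l i - 1) * δ + p j * κ) = B₂ at *
    generalize br (x i - y j + (p j - 1) * κ) = B₃ at *
    generalize br (x i - y j + p j * κ) = B₄ at *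
    generalize br (x i - y j + (p j - 2) * κ) = B₅ at *
    field_simp
  · have hli : (l i : ℂ) = μ i := by simp [hl, hi]
    have hpj : (p j : ℂ) = ν j + 1 := by simp [hp, hj]
    have d3 := hneg (x i - y j + (p j - 2) * κ) (y j - x i + (ν j - 1) * -κ) (by rw [hpj]; ring)
    have d4 := heq (x i - y j + (p j - 2) * κ) (x i + δ * 0 - (y j - κ * ν j) - κ)
      (by rw [hpj]; ring)
    have d5 := heq (x i - y j + l i * δ + (p j - 1) * κ)
      (x i + δ * 0 - (y j - κ * ν j) + μ i * δ) (by rw [hpj, hli]; ring)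
    simp only [mixFactor, commonMix, xshiftI, yshiftMu, hi, hj, if_true, not_true, false_and,
      if_false, d2, d3, d4, d5]
    generalize br (x i - y j + l i * δ + (p j - 1) * κ) = B₁ at *
    generalize br (x i - y j + (l i - 1) * δ + p j * κ) = B₂ at *
    generalize br (x i - y j + (p j - 1) * κ) = B₃ at *
    generalize br (x i - y j + p j * κ) = B₄ at *
    generalize br (x i - y j + (p j - 2) * κ) = B₅ at *
    field_simp
  · have hli : (l i : ℂ) = μ i := by simp [hl, hi]
    have hpj : (p j : ℂ) = ν j := by simp [hp, hj]
    have d3 := hneg (x i - y j + (p j - 1) * κ) (y j - x i + (ν j - 1) * -κ) (by rw [hpj]; ring)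
    have d4 := heq (x i - y j + p j * κ - δ) (x i + δ * 0 - (y j - κ * ν j) - δ)
      (by rw [hpj]; ring)
    have d5 := heq (x i - y j + (l i - 1) * δ + p j * κ)
      (x i + δ * 0 - (y j - κ * ν j) + (μ i - 1) * δ) (by rw [hpj, hli]; ring)
    simp only [mixFactor, commonMix, xshiftI, yshiftMu, hi, hj, if_true,
      if_false, not_false_iff, and_self, d2, d3, d4, d5]
    generalize br (x i - y j + l i * δ + (p j - 1) * κ) = B₁ at *
    generalize br (x i - y j + (l i - 1) * δ + p j * κ) = B₂ at *
    generalize br (x i - y j + (p j - 1) * κ) = B₃ at *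
    generalize br (x i - y j + p j * κ) = B₄ at *
    generalize br (x i - y j + (p j - 2) * κ) = B₅ at *
    field_simp

end Coefficients

section Terms

variable {br : ℂ → ℂ} {m r : ℕ}

lemma prod_prod_sum_type {A B : Type*} [Fintype A] [Fintype B] (T : A ⊕ B → A ⊕ B → ℂ) :
    ∏ u, ∏ v, T u v
      = (∏ i, ∏ i', T (.inl i) (.inl i'))
        * (∏ i, ∏ j, T (.inl i) (.inr j) * T (.inr j) (.inl i))
        * ∏ j, ∏ j', T (.inr j) (.inr j') := by
  simp only [Fintype.prod_sum_type, prod_mul_distrib]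
  rw [prod_comm (f := fun i j => T (.inr j) (.inl i))]
  ring

/-- The first family of arguments of the subset sums that describe the products of operators. -/
def sourcePoint (κ : ℂ) (p : Fin r → ℕ) (x : Fin m → ℂ) (y : Fin r → ℂ) : Fin m ⊕ Fin r → ℂ :=
  Sum.elim x fun j => y j - (p j - 1) * κ

/-- The second family of arguments of the subset sums that describe the products of operators. -/
def targetPoint (δ : ℂ) (l : Fin m → ℕ) (x : Fin m → ℂ) (y : Fin r → ℂ) : Fin m ⊕ Fin r → ℂ :=
  Sum.elim (fun i => x i + l i * δ) fun j => y j + δ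

/-- The factor shared by all products of coefficients with a given total shift. -/
noncomputable def commonFactor (br : ℂ → ℂ) (δ κ : ℂ) (l : Fin m → ℕ) (p : Fin r → ℕ)
    (x : Fin m → ℂ) (y : Fin r → ℂ) : ℂ :=
  (∏ i, ∏ j, commonSelf br δ κ l x i j) * (∏ i, ∏ j, commonMix br δ κ l p x y i j)
    * ∏ i, ∏ j, commonSelf br (-κ) (-δ) p y i j

variable (hodd : ∀ z : ℂ, br (-z) = -br z)

include hodd in
lemma commonFactor_swap (δ κ : ℂ) (l : Fin m → ℕ) (p : Fin r → ℕ)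
    (x : Fin m → ℂ) (y : Fin r → ℂ) :
    commonFactor br (-κ) (-δ) p l y x = commonFactor br δ κ l p x y := by
  have hmix : ∀ i j, commonMix br (-κ) (-δ) p l y x j i = commonMix br δ κ l p x y i j := by
    intro i j
    have e1 : y j - x i + p j * -κ + (l i - 1) * -δ
      = -(x i - y j + (l i - 1) * δ + p j * κ) := by ring
    have e2 : y j - x i + (p j - 1) * -κ + l i * -δ
      = -(x i - y j + l i * δ + (p j - 1) * κ) := by ring
    simp only [commonMix, e1, e2, hodd]
    ring
  simp only [commonFactor, neg_neg]
  rw [prod_comm (f := fun j i => commonMix br (-κ) (-δ) p l y x j i)]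
  simp only [hmix]
  ring

include hodd in
lemma Coef_mul_Coef {δ κ : ℂ} {x : Fin m → ℂ} {y : Fin r → ℂ} (h : IsGeneric br δ κ x y)
    (J : Finset (Fin m)) (μ l : Fin m → ℕ) (hl : ∀ i, l i = μ i + if i ∈ J then 1 else 0)
    (I : Finset (Fin r)) (ν p : Fin r → ℕ) (hp : ∀ i, p i = ν i + if i ∈ I then 1 else 0) :
    Coef br (-κ) (-δ) ν J y x * Coef br δ κ μ I (xshiftI δ J x) (yshiftMu κ ν y)
      = (-1) ^ (J.card + I.card) * (-1) ^ (r * r) * commonFactor br δ κ l p x y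
        * dualTerm br (δ - κ) (sourcePoint κ p x y) (targetPoint δ l x y) (J.disjSum Iᶜ) := by
  obtain ⟨T, hT⟩ : ∃ T : Fin m ⊕ Fin r → Fin m ⊕ Fin r → ℂ, T = fun u v =>
    (if u ∈ J.disjSum Iᶜ ∧ v ∉ J.disjSum Iᶜ then
        br (sourcePoint κ p x y u - sourcePoint κ p x y v + (δ - κ))
          / br (sourcePoint κ p x y u - sourcePoint κ p x y v) else 1)
      * (if u ∈ J.disjSum Iᶜ then br (sourcePoint κ p x y u - targetPoint δ l x y v)
          else br (sourcePoint κ p x y u - targetPoint δ l x y v + (δ - κ))) := ⟨_, rfl⟩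
  have hD : dualTerm br (δ - κ) (sourcePoint κ p x y) (targetPoint δ l x y) (J.disjSum Iᶜ)
      = ∏ u, ∏ v, T u v := by rw [hT, dualTerm]
  have hxx : (∏ i, ∏ j, cutFactor br (-κ) J x i j)
      * (∏ i, ∏ j, selfFactor br δ κ μ (xshiftI δ J x) i j)
      = (∏ i, ∏ j, commonSelf br δ κ l x i j) * ∏ i, ∏ j, T (.inl i) (.inl j) := by
    simp only [← prod_mul_distrib, prod_xx_eq hodd h J μ l hl, hT, inl_mem_disjSum, sourcePoint,
      targetPoint, Sum.elim_inl]
  have hyy : (∏ i, ∏ j, selfFactor br (-κ) (-δ) ν y i j)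
      * (∏ i, ∏ j, cutFactor br δ I (yshiftMu κ ν y) i j)
      = (-1) ^ (r * r) * ((∏ i, ∏ j, commonSelf br (-κ) (-δ) p y i j)
        * ∏ i, ∏ j, T (.inr i) (.inr j)) := by
    simp only [← prod_mul_distrib, prod_yy_eq hodd h I ν p hp, hT, inr_mem_disjSum, sourcePoint,
      targetPoint, Sum.elim_inr, mem_compl, not_not]
  have hmix : (∏ j, ∏ i, mixFactor br (-κ) (-δ) ν J y x j i)
      * (∏ i, ∏ j, mixFactor br δ κ μ I (xshiftI δ J x) (yshiftMu κ ν y) i j)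
      = (∏ i, ∏ j, commonMix br δ κ l p x y i j)
        * ∏ i, ∏ j, T (.inl i) (.inr j) * T (.inr j) (.inl i) := by
    rw [prod_comm]
    simp only [← prod_mul_distrib, mixFactor_mul_mixFactor hodd h J μ l hl I ν p hp, hT,
      inl_mem_disjSum, inr_mem_disjSum, mem_compl, not_not, sourcePoint, targetPoint,
      Sum.elim_inl, Sum.elim_inr]
  rw [Coef_eq, Coef_eq, hD, prod_prod_sum_type, commonFactor, pow_add]
  clear hD hT
  calc _ = (-1) ^ J.card * (-1) ^ I.card
        * ((∏ i, ∏ j, cutFactor br (-κ) J x i j)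
          * (∏ i, ∏ j, selfFactor br δ κ μ (xshiftI δ J x) i j))
        * ((∏ i, ∏ j, selfFactor br (-κ) (-δ) ν y i j)
          * (∏ i, ∏ j, cutFactor br δ I (yshiftMu κ ν y) i j))
        * ((∏ j, ∏ i, mixFactor br (-κ) (-δ) ν J y x j i)
          * (∏ i, ∏ j, mixFactor br δ κ μ I (xshiftI δ J x) (yshiftMu κ ν y) i j)) := by ring
    _ = _ := by
      rw [hxx, hyy, hmix]
      ring

include hodd in
lemma dualTerm_compl {N : Type*} [Fintype N] [DecidableEq N] (a b : ℂ) (x w : N → ℂ)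
    (K : Finset N) :
    dualTerm br (a - b) (fun i => w i - a) (fun i => x i - b) Kᶜ
      = (-1) ^ (Fintype.card N * Fintype.card N) * dualTerm br (a - b) (-w) (-x) K := by
  have hsign : (-1 : ℂ) ^ (Fintype.card N * Fintype.card N) = ∏ _i : N, ∏ _j : N, (-1 : ℂ) := by
    simp [pow_mul]
  have hneg : ∀ u v : ℂ, v = -u → br v = -br u := fun u v e => by rw [e, hodd]
  rw [hsign]
  simp only [dualTerm, prod_mul_distrib]
  rw [prod_comm, mul_left_comm]
  congr 1
  · refine prod_congr rfl fun i _ => prod_congr rfl fun j _ => ?_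
    simp only [mem_compl, not_not, Pi.neg_apply, sub_sub_sub_cancel_right, neg_sub_neg]
    simp only [and_comm]
  · simp only [← prod_mul_distrib]
    refine prod_congr rfl fun i _ => prod_congr rfl fun j _ => ?_
    simp only [mem_compl, Pi.neg_apply]
    by_cases hi : i ∈ K
    · simp only [hi, not_true, if_false, if_true]
      rw [hneg (-w i - -x j) _ (by ring), neg_one_mul]
    · simp only [hi, not_false_iff, if_false, if_true]
      rw [hneg (-w i - -x j + (a - b)) _ (by ring), neg_one_mul]

include hodd in
lemma Coef_mul_Coef_reversed {δ κ : ℂ} {x : Fin m → ℂ} {y : Fin r → ℂ}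
    (h : IsGeneric br δ κ x y)
    (J : Finset (Fin m)) (μ l : Fin m → ℕ) (hl : ∀ i, l i = μ i + if i ∈ J then 1 else 0)
    (I : Finset (Fin r)) (ν p : Fin r → ℕ) (hp : ∀ i, p i = ν i + if i ∈ I then 1 else 0) :
    Coef br δ κ μ I x y * Coef br (-κ) (-δ) ν J (yshift κ I y) (xshift δ μ x)
      = (-1) ^ (J.card + I.card) * (-1) ^ (r * r) * commonFactor br δ κ l p x y
        * dualTerm br (δ - κ) (-targetPoint δ l x y) (-sourcePoint κ p x y) (J.disjSum Iᶜ) := by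
  have key := Coef_mul_Coef hodd (h.swap hodd) I ν p hp J μ l hl
  have e1 : xshiftI (-κ) I y = yshift κ I y := by
    funext j; simp only [xshiftI, yshift]; ring
  have e2 : yshiftMu (-δ) μ x = xshift δ μ x := by
    funext j; simp only [xshift, yshiftMu]; ring
  rw [neg_neg, neg_neg, e1, e2, commonFactor_swap hodd] at key
  rw [key]
  have hX : sourcePoint (-δ) l y x
      = (fun u => targetPoint δ l x y u - δ) ∘ Equiv.sumComm (Fin r) (Fin m) := by
    funext u
    rcases u with u | u <;> simp [sourcePoint, targetPoint]
    ring
  have hY : targetPoint (-κ) p y x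
      = (fun u => sourcePoint κ p x y u - κ) ∘ Equiv.sumComm (Fin r) (Fin m) := by
    funext u
    rcases u with u | u <;> simp [sourcePoint, targetPoint]
    · ring
    · ring
  have hK : (Equiv.sumComm (Fin r) (Fin m)).finsetCongr (I.disjSum Jᶜ) = (J.disjSum Iᶜ)ᶜ := by
    ext u
    rcases u with u | u <;> simp
  have hc : -κ - -δ = δ - κ := by ring
  rw [hX, hY, hc, dualTerm_comp_equiv, hK, dualTerm_compl hodd]
  have hpar : (-1 : ℂ) ^ (r * r)
      = (-1) ^ (m * m) * (-1) ^ (Fintype.card (Fin m ⊕ Fin r) * Fintype.card (Fin m ⊕ Fin r)) := by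
    rw [← pow_add, Fintype.card_sum, Fintype.card_fin, Fintype.card_fin,
      show m * m + (m + r) * (m + r) = 2 * (m * m + m * r) + r * r by ring, pow_add, pow_mul]
    simp
  rw [hpar, add_comm J.card]
  ring

end Terms

section Regrouping

variable {br : ℂ → ℂ} {m r : ℕ}

lemma mem_idxSet {k : ℕ} {p : (Fin m → ℕ) × Finset (Fin r)} :
    p ∈ idxSet m r k ↔ (∑ i, p.1 i) + p.2.card = k := by
  simp only [idxSet, mem_filter, mem_product, Fintype.mem_piFinset, mem_range, mem_univ, and_true,
    and_iff_right_iff_imp]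
  intro h i
  have := single_le_sum (f := p.1) (fun _ _ => Nat.zero_le _) (mem_univ i)
  omega

/-- The multi-index `μ` increased by the indicator vector of `J`. -/
def addInd (μ : Fin m → ℕ) (J : Finset (Fin m)) : Fin m → ℕ :=
  fun i => μ i + if i ∈ J then 1 else 0

lemma sum_addInd (μ : Fin m → ℕ) (J : Finset (Fin m)) :
    ∑ i, addInd μ J i = (∑ i, μ i) + J.card := by
  simp [addInd, sum_add_distrib]

lemma addInd_left_injective (J : Finset (Fin m)) : Function.Injective fun μ => addInd μ J := by
  intro μ μ' h
  funext i
  exact Nat.add_right_cancel (congrFun h i)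

lemma addInd_tsub {μ : Fin m → ℕ} {J : Finset (Fin m)} (h : ∀ i ∈ J, μ i ≠ 0) :
    addInd (fun i => μ i - if i ∈ J then 1 else 0) J = μ := by
  funext i
  by_cases hi : i ∈ J
  · have := h i hi
    simp only [addInd, hi, if_true]
    omega
  · simp [addInd, hi]

/-- The total shift produced by a pair of summation indices. -/
def totalShift (q : ((Fin r → ℕ) × Finset (Fin m)) × ((Fin m → ℕ) × Finset (Fin r))) :
    (Fin m → ℕ) × (Fin r → ℕ) :=
  (addInd q.2.1 q.1.2, addInd q.1.1 q.2.2)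

lemma sum_totalShift_eq {k l : ℕ}
    (q₀ : ((Fin r → ℕ) × Finset (Fin m)) × ((Fin m → ℕ) × Finset (Fin r)))
    (h₀ : q₀ ∈ idxSet r m k ×ˢ idxSet m r l) (T : Finset (Fin m ⊕ Fin r) → ℂ)
    (hT : ∀ K i, Sum.inl i ∈ K → (totalShift q₀).1 i = 0 → T K = 0)
    (hT' : ∀ K j, Sum.inr j ∉ K → (totalShift q₀).2 j = 0 → T K = 0) :
    ∑ q ∈ idxSet r m k ×ˢ idxSet m r l with totalShift q = totalShift q₀,
        T (q.1.2.disjSum q.2.2ᶜ)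
      = ∑ K ∈ powersetCard (q₀.1.2.card + (r - q₀.2.2.card)) univ, T K := by
  rw [mem_product, mem_idxSet, mem_idxSet] at h₀
  have hs₁ := sum_addInd q₀.2.1 q₀.1.2
  have hs₂ := sum_addInd q₀.1.1 q₀.2.2
  have hc₀ := card_le_univ q₀.2.2
  rw [Fintype.card_fin] at hc₀
  refine sum_of_injOn (fun q => q.1.2.disjSum q.2.2ᶜ) ?_ ?_ ?_ (fun q _ => rfl)
  · rintro ⟨⟨ν, J⟩, ⟨μ, I⟩⟩ hq ⟨⟨ν', J'⟩, ⟨μ', I'⟩⟩ hq' hK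
    have hJ : J = J' := by
      ext i
      simpa using congrArg (Sum.inl i ∈ ·) hK
    have hI : I = I' := by
      ext j
      have := congrArg (Sum.inr j ∈ ·) hK
      simpa [not_iff_not] using this
    subst hJ hI
    have e := (mem_filter.mp hq).2.trans (mem_filter.mp hq').2.symm
    simp only [totalShift, Prod.mk.injEq] at e
    rw [addInd_left_injective J e.1, addInd_left_injective I e.2]
  · rintro ⟨⟨ν, J⟩, ⟨μ, I⟩⟩ hq
    obtain ⟨hq, e⟩ := mem_filter.mp hq
    rw [mem_product, mem_idxSet, mem_idxSet] at hq
    simp only [totalShift, Prod.mk.injEq] at e hq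
    have hc := card_le_univ I
    rw [Fintype.card_fin] at hc
    have t := sum_addInd ν I
    rw [e.2] at t
    simp only [mem_coe, mem_powersetCard, card_disjSum,
      card_compl, Fintype.card_fin, subset_univ, true_and]
    omega
  · intro K hK hK'
    by_contra hne
    apply hK'
    have hc := (mem_powersetCard.mp hK).2
    let J : Finset (Fin m) := univ.filter fun i => Sum.inl i ∈ K
    let I : Finset (Fin r) := univ.filter fun j => Sum.inr j ∉ K
    have hKeq : J.disjSum Iᶜ = K := by
      ext u
      rcases u with u | u <;> simp [I, J]
    have a₁ := addInd_tsub (μ := (totalShift q₀).1) (J := J) fun i hi h0 =>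
      hne (hT K i (by simpa [J] using hi) h0)
    have a₂ := addInd_tsub (μ := (totalShift q₀).2) (J := I) fun j hj h0 =>
      hne (hT' K j (by simpa [I] using hj) h0)
    have b₁ := sum_addInd (fun i => (totalShift q₀).1 i - if i ∈ J then 1 else 0) J
    have b₂ := sum_addInd (fun i => (totalShift q₀).2 i - if i ∈ I then 1 else 0) I
    rw [a₁] at b₁
    rw [a₂] at b₂
    have hcI := card_le_univ I
    rw [← hKeq, card_disjSum, card_compl] at hc
    rw [Fintype.card_fin] at hc hcI
    refine ⟨((fun j => (totalShift q₀).2 j - if j ∈ I then 1 else 0, J),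
      (fun i => (totalShift q₀).1 i - if i ∈ J then 1 else 0, I)), ?_, hKeq⟩
    rw [mem_coe, mem_filter, mem_product, mem_idxSet, mem_idxSet]
    refine ⟨⟨?_, ?_⟩, ?_⟩
    · simp only [totalShift] at b₁ b₂ ⊢
      omega
    · simp only [totalShift] at b₁ b₂ ⊢
      omega
    · rw [totalShift, a₁, a₂]

lemma dualTerm_eq_zero_of_mem {N : Type*} [Fintype N] [DecidableEq N] {c : ℂ} {x w : N → ℂ}
    {K : Finset N} {u : N} (hu : u ∈ K) (h : br (x u - w u) = 0) : dualTerm br c x w K = 0 :=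
  prod_eq_zero (mem_univ u) (prod_eq_zero (mem_univ u) (by simp [hu, h]))

lemma dualTerm_eq_zero_of_notMem {N : Type*} [Fintype N] [DecidableEq N] {c : ℂ} {x w : N → ℂ}
    {K : Finset N} {u : N} (hu : u ∉ K) (h : br (x u - w u + c) = 0) :
    dualTerm br c x w K = 0 :=
  prod_eq_zero (mem_univ u) (prod_eq_zero (mem_univ u) (by simp [hu, h]))

variable (hodd : ∀ z : ℂ, br (-z) = -br z)

include hodd in
lemma IsGeneric.sourcePoint_ne {δ κ : ℂ} {x : Fin m → ℂ} {y : Fin r → ℂ}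
    (h : IsGeneric br δ κ x y) (p : Fin r → ℕ) (u v : Fin m ⊕ Fin r) (huv : u ≠ v) :
    br (sourcePoint κ p x y u - sourcePoint κ p x y v) ≠ 0 := by
  rcases u with u | u <;> rcases v with v | v <;>
    simp only [sourcePoint, Sum.elim_inl, Sum.elim_inr]
  · exact ne_zero_of_eq (h.xx u v (by simpa using huv) 0 0) (by push_cast; ring)
  · exact ne_zero_of_eq (h.xy u v 0 (p v - 1)) (by push_cast; ring)
  · rw [br_sub_comm hodd, neg_ne_zero]
    exact ne_zero_of_eq (h.xy v u 0 (p u - 1)) (by push_cast; ring)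
  · exact ne_zero_of_eq (h.yy u v (by simpa using huv) 0 (p v - p u)) (by push_cast; ring)

include hodd in
lemma IsGeneric.targetPoint_ne {δ κ : ℂ} {x : Fin m → ℂ} {y : Fin r → ℂ}
    (h : IsGeneric br δ κ x y) (l : Fin m → ℕ) (u v : Fin m ⊕ Fin r) (huv : u ≠ v) :
    br (targetPoint δ l x y u - targetPoint δ l x y v) ≠ 0 := by
  rcases u with u | u <;> rcases v with v | v <;>
    simp only [targetPoint, Sum.elim_inl, Sum.elim_inr]
  · exact ne_zero_of_eq (h.xx u v (by simpa using huv) (l u - l v) 0) (by push_cast; ring)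
  · exact ne_zero_of_eq (h.xy u v (l u - 1) 0) (by push_cast; ring)
  · rw [br_sub_comm hodd, neg_ne_zero]
    exact ne_zero_of_eq (h.xy v u (l v - 1) 0) (by push_cast; ring)
  · exact ne_zero_of_eq (h.yy u v (by simpa using huv) 0 0) (by push_cast; ring)

variable (hent : Differentiable ℂ br) (hnz : br ≠ 0)
    (hW : ∀ a b c d : ℂ,
      br (a + b) * br (a - b) * br (c + d) * br (c - d)
        + br (a + d) * br (a - d) * br (b + c) * br (b - c)
        = br (a + c) * br (a - c) * br (b + d) * br (b - d))

include hodd hent hnz hW in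
lemma IsGeneric.sum_dualTerm_totalShift {δ κ : ℂ} {x : Fin m → ℂ} {y : Fin r → ℂ}
    (h : IsGeneric br δ κ x y) {k l : ℕ}
    (q₀ : ((Fin r → ℕ) × Finset (Fin m)) × ((Fin m → ℕ) × Finset (Fin r)))
    (h₀ : q₀ ∈ idxSet r m k ×ˢ idxSet m r l) :
    ∑ q ∈ idxSet r m k ×ˢ idxSet m r l with totalShift q = totalShift q₀,
        dualTerm br (δ - κ) (sourcePoint κ (totalShift q₀).2 x y)
          (targetPoint δ (totalShift q₀).1 x y) (q.1.2.disjSum q.2.2ᶜ)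
      = ∑ q ∈ idxSet r m k ×ˢ idxSet m r l with totalShift q = totalShift q₀,
        dualTerm br (δ - κ) (-targetPoint δ (totalShift q₀).1 x y)
          (-sourcePoint κ (totalShift q₀).2 x y) (q.1.2.disjSum q.2.2ᶜ) := by
  have hzero : br 0 = 0 := by
    have := hodd 0
    rw [neg_zero] at this
    exact self_eq_neg.mp this
  have hz₁ : ∀ i, (totalShift q₀).1 i = 0 → br (sourcePoint κ (totalShift q₀).2 x y (.inl i)
      - targetPoint δ (totalShift q₀).1 x y (.inl i)) = 0 := by
    intro i hi
    rw [← hzero]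
    simp [sourcePoint, targetPoint, hi]
  have hz₂ : ∀ j, (totalShift q₀).2 j = 0 → br (sourcePoint κ (totalShift q₀).2 x y (.inr j)
      - targetPoint δ (totalShift q₀).1 x y (.inr j) + (δ - κ)) = 0 := by
    intro j hj
    rw [← hzero]
    simp only [sourcePoint, targetPoint, Sum.elim_inr, hj]
    congr 1
    push_cast
    ring
  rw [sum_totalShift_eq q₀ h₀ (dualTerm br (δ - κ) (sourcePoint κ (totalShift q₀).2 x y)
          (targetPoint δ (totalShift q₀).1 x y))
      (fun K i hi h0 => dualTerm_eq_zero_of_mem hi (hz₁ i h0))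
      (fun K j hj h0 => dualTerm_eq_zero_of_notMem hj (hz₂ j h0)),
    sum_totalShift_eq q₀ h₀ (dualTerm br (δ - κ) (-targetPoint δ (totalShift q₀).1 x y)
          (-sourcePoint κ (totalShift q₀).2 x y))
      (fun K i hi h0 => dualTerm_eq_zero_of_mem hi
        (by simpa only [Pi.neg_apply, neg_sub_neg] using hz₁ i h0))
      (fun K j hj h0 => dualTerm_eq_zero_of_notMem hj
        (by simpa only [Pi.neg_apply, neg_sub_neg] using hz₂ j h0))]
  exact sum_dualTerm hodd hent hnz hW _ _ _ _ (h.sourcePoint_ne hodd _) (h.targetPoint_ne hodd _)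

include hodd hent hnz hW in
/-- The commutation relation at a generic point, for arbitrary weights of the total shifts. -/
lemma IsGeneric.sum_Coef_mul_Coef {δ κ : ℂ} {x : Fin m → ℂ} {y : Fin r → ℂ}
    (h : IsGeneric br δ κ x y) (k l : ℕ) (G : (Fin m → ℕ) × (Fin r → ℕ) → ℂ) :
    ∑ q ∈ idxSet r m k ×ˢ idxSet m r l,
        Coef br (-κ) (-δ) q.1.1 q.1.2 y x
          * Coef br δ κ q.2.1 q.2.2 (xshiftI δ q.1.2 x) (yshiftMu κ q.1.1 y) * G (totalShift q)
      = ∑ q ∈ idxSet r m k ×ˢ idxSet m r l,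
        Coef br δ κ q.2.1 q.2.2 x y
          * Coef br (-κ) (-δ) q.1.1 q.1.2 (yshift κ q.2.2 y) (xshift δ q.2.1 x)
          * G (totalShift q) := by
  have hmaps : ∀ q ∈ idxSet r m k ×ˢ idxSet m r l,
      totalShift q ∈ (idxSet r m k ×ˢ idxSet m r l).image totalShift :=
    fun q hq => mem_image_of_mem _ hq
  rw [← sum_fiberwise_of_maps_to hmaps, ← sum_fiberwise_of_maps_to hmaps]
  refine sum_congr rfl fun t ht => ?_
  obtain ⟨q₀, h₀, rfl⟩ := mem_image.mp ht
  have hsign : ∀ q ∈ (idxSet r m k ×ˢ idxSet m r l).filter (totalShift · = totalShift q₀),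
      (-1 : ℂ) ^ (q.1.2.card + q.2.2.card) = (-1) ^ (k + ∑ j, (totalShift q₀).2 j) := by
    intro q hq
    obtain ⟨hq, e⟩ := mem_filter.mp hq
    rw [mem_product, mem_idxSet, mem_idxSet] at hq
    have t := sum_addInd q.1.1 q.2.2
    rw [← e]
    refine neg_one_pow_congr ?_
    simp only [totalShift, Nat.even_iff, t]
    omega
  let C : ℂ := (-1) ^ (k + ∑ j, (totalShift q₀).2 j) * (-1) ^ (r * r)
    * commonFactor br δ κ (totalShift q₀).1 (totalShift q₀).2 x y * G (totalShift q₀)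
  have key := congrArg (C * ·) (h.sum_dualTerm_totalShift hodd hent hnz hW q₀ h₀)
  simp only [mul_sum] at key
  convert key using 1
  · refine sum_congr rfl fun q hq => ?_
    have e := (mem_filter.mp hq).2
    rw [Coef_mul_Coef hodd h q.1.2 q.2.1 (totalShift q).1 (fun _ => rfl) q.2.2 q.1.1
      (totalShift q).2 (fun _ => rfl), hsign q hq, e]
    ring
  · refine sum_congr rfl fun q hq => ?_
    have e := (mem_filter.mp hq).2
    rw [Coef_mul_Coef_reversed hodd h q.1.2 q.2.1 (totalShift q).1 (fun _ => rfl) q.2.2 q.1.1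
      (totalShift q).2 (fun _ => rfl), hsign q hq, e]
    ring

end Regrouping

section Continuity

variable {br : ℂ → ℂ} {m r : ℕ}

lemma dense_isGeneric (hent : Differentiable ℂ br) (hnz : br ≠ 0) :
    Dense {p : (Fin m → ℂ) × (Fin r → ℂ) × ℂ × ℂ | IsGeneric br p.2.2.1 p.2.2.2 p.1 p.2.1} := by
  let E := (Fin m → ℂ) × (Fin r → ℂ) × ℂ × ℂ
  let coord : Fin m ⊕ Fin r → E →L[ℂ] ℂ := Sum.elim
    (fun i => (ContinuousLinearMap.proj i).comp (ContinuousLinearMap.fst ℂ _ _))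
    (fun j => ((ContinuousLinearMap.proj j).comp (ContinuousLinearMap.fst ℂ _ _)).comp
      (ContinuousLinearMap.snd ℂ _ _))
  let params : E →L[ℂ] ℂ × ℂ :=
    (ContinuousLinearMap.snd ℂ _ _).comp (ContinuousLinearMap.snd ℂ _ _)
  let dl : E →L[ℂ] ℂ := (ContinuousLinearMap.fst ℂ _ _).comp params
  let kp : E →L[ℂ] ℂ := (ContinuousLinearMap.snd ℂ _ _).comp params
  let L : {q : ((Fin m ⊕ Fin r) × (Fin m ⊕ Fin r)) × ℤ × ℤ // q.1.1 ≠ q.1.2}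
      ⊕ {q : ℤ × ℤ // q.1 ≠ 0 ∨ q.2 ≠ 0} → E →L[ℂ] ℂ := Sum.elim
    (fun q => coord q.1.1.1 - coord q.1.1.2 + (q.1.2.1 : ℂ) • dl + (q.1.2.2 : ℂ) • kp)
    (fun q => (q.1.1 : ℂ) • dl + (q.1.2 : ℂ) • kp)
  have hcoord : ∀ u (p : E), coord u p = Sum.elim p.1 p.2.1 u := by
    rintro (u | u) p <;> rfl
  have hdl : ∀ p : E, dl p = p.2.2.1 := fun _ => rfl
  have hkp : ∀ p : E, kp p = p.2.2.2 := fun _ => rfl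
  have hL : ∀ i, L i ≠ 0 := by
    rintro (⟨⟨⟨u, v⟩, n, k⟩, huv⟩ | ⟨⟨n, k⟩, hnk⟩) h0
    · let P : E := (fun i => if Sum.inl i = u then 1 else 0,
        fun j => if Sum.inr j = u then 1 else 0, 0, 0)
      have hP : ∀ w, coord w P = if w = u then 1 else 0 := by
        rintro (w | w) <;> simp [hcoord, P]
      have := congrArg (fun f => f P) h0
      simp [L, hP, Ne.symm huv, hdl, hkp, P] at this
    · rcases hnk with hn | hk
      · have := congrArg (fun f => f ((0, 0, 1, 0) : E)) h0
        simp only [L, Sum.elim_inr, add_apply, smul_apply,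
          hdl, hkp, smul_eq_mul, mul_one, mul_zero, add_zero, zero_apply] at this
        exact hn (by exact_mod_cast this)
      · have := congrArg (fun f => f ((0, 0, 0, 1) : E)) h0
        simp only [L, Sum.elim_inr, add_apply, smul_apply,
          hdl, hkp, smul_eq_mul, mul_one, mul_zero, zero_add, zero_apply] at this
        exact hk (by exact_mod_cast this)
  refine (dense_forall_br_linear_ne_zero hent hnz L hL fun _ => 0).mono fun p hp => ?_
  simp only [add_zero] at hp
  exact {
    xx := fun i j hij n k => hp (.inl ⟨((.inl i, .inl j), n, k), by simpa using hij⟩)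
    yy := fun i j hij n k => hp (.inl ⟨((.inr i, .inr j), n, k), by simpa using hij⟩)
    xy := fun i j n k => hp (.inl ⟨((.inl i, .inr j), n, k), by simp⟩)
    params := fun n k hnk => hp (.inr ⟨(n, k), hnk⟩) }

lemma continuousAt_Coef (hent : Differentiable ℂ br) {E : Type*} [TopologicalSpace E] {p : E}
    {a b : E → ℂ} {x : E → Fin m → ℂ} {y : E → Fin r → ℂ} (ha : Continuous a)
    (hb : Continuous b) (hx : Continuous x) (hy : Continuous y) (μ : Fin m → ℕ)
    (I : Finset (Fin r)) (h : CDenomNZ br (a p) μ I (x p) (y p)) :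
    ContinuousAt (fun q => Coef br (a q) (b q) μ I (x q) (y q)) p := by
  have hbr := hent.continuous
  obtain ⟨h1, h2, h3, h4, h5⟩ := h
  have hx' : ∀ i, Continuous fun q => x q i := fun i => (continuous_apply i).comp hx
  have hy' : ∀ i, Continuous fun q => y q i := fun i => (continuous_apply i).comp hy
  simp only [sfac_natCast] at h3
  simp only [Coef, sfac_natCast]
  have hprod : ∀ (n : ℕ) {c z : E → ℂ}, Continuous c → Continuous z →
      Continuous fun q => bracketProd br (c q) (z q) n := by
    intro n c z hc hz
    unfold bracketProd
    fun_prop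
  refine ((((continuousAt_const).mul ?_).mul ?_).mul ?_).mul ?_
  · refine tendsto_finsetProd _ fun i _ => tendsto_finsetProd _ fun j _ => ?_
    by_cases hij : i < j
    · simp only [hij, if_true]
      exact ContinuousAt.div (by fun_prop) (by fun_prop) (h1 i j hij)
    · simp only [hij, if_false]
      exact tendsto_const_nhds
  · refine tendsto_finsetProd _ fun i hi => tendsto_finsetProd _ fun j hj => ?_
    exact ContinuousAt.div (by fun_prop) (by fun_prop) (h2 i hi j hj)
  · refine tendsto_finsetProd _ fun i _ => tendsto_finsetProd _ fun j _ => ?_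
    exact ContinuousAt.div (hprod _ ha (by fun_prop)).continuousAt
      (hprod _ ha (by fun_prop)).continuousAt (h3 i j)
  · refine tendsto_finsetProd _ fun i _ => ContinuousAt.mul ?_ ?_
    · refine tendsto_finsetProd _ fun j hj => ?_
      exact ContinuousAt.div (by fun_prop) (by fun_prop) (h4 i j hj)
    · refine tendsto_finsetProd _ fun j hj => ?_
      exact ContinuousAt.div (by fun_prop) (by fun_prop) (h5 i j hj)

end Continuity

/-- The operators `D_{m,r}^{(k)}` and `H_{m,r}^{(l)}` commute
at every admissible point. -/
theorem Dop_Hop_commute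
    (br : ℂ → ℂ) (hodd : ∀ z : ℂ, br (-z) = -br z)
    (hent : Differentiable ℂ br) (hnz : br ≠ 0)
    (hW : ∀ a b c d : ℂ,
      br (a + b) * br (a - b) * br (c + d) * br (c - d)
        + br (a + d) * br (a - d) * br (b + c) * br (b - c)
        = br (a + c) * br (a - c) * br (b + d) * br (b - d))
    (δ κ : ℂ)
    (hδ : ∀ n : ℕ, 1 ≤ n → br ((n : ℂ) * δ) ≠ 0)
    (hκ : ∀ n : ℕ, 1 ≤ n → br ((n : ℂ) * κ) ≠ 0)
    (m r k l : ℕ) (F : (Fin m → ℂ) → (Fin r → ℂ) → ℂ)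
    (x : Fin m → ℂ) (y : Fin r → ℂ)
    (h1 : ∀ p ∈ idxSet r m k, CDenomNZ br (-κ) p.1 p.2 y x)
    (h2 : ∀ p ∈ idxSet m r l, CDenomNZ br δ p.1 p.2 x y)
    (h3 : ∀ p ∈ idxSet r m k, ∀ q ∈ idxSet m r l,
      CDenomNZ br δ q.1 q.2 (xshiftI δ p.2 x) (yshiftMu κ p.1 y))
    (h4 : ∀ p ∈ idxSet m r l, ∀ q ∈ idxSet r m k,
      CDenomNZ br (-κ) q.1 q.2 (yshift κ p.2 y) (xshift δ p.1 x)) :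
    Dop br δ κ m r k (fun x' y' => Hop br δ κ m r l F x' y') x y
      = Hop br δ κ m r l (fun x' y' => Dop br δ κ m r k F x' y') x y := by
  let G : (Fin m → ℕ) × (Fin r → ℕ) → ℂ := fun t => F (xshift δ t.1 x) (yshiftMu κ t.2 y)
  have hFDH : ∀ q : ((Fin r → ℕ) × Finset (Fin m)) × ((Fin m → ℕ) × Finset (Fin r)),
      F (xshift δ q.2.1 (xshiftI δ q.1.2 x)) (yshift κ q.2.2 (yshiftMu κ q.1.1 y))
        = G (totalShift q) := by
    intro q
    simp only [G, totalShift]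
    congr 1
    · funext i
      simp only [xshift, xshiftI, addInd]
      push_cast
      ring
    · funext j
      simp only [yshift, yshiftMu, addInd]
      push_cast
      ring
  have hFHD : ∀ q : ((Fin r → ℕ) × Finset (Fin m)) × ((Fin m → ℕ) × Finset (Fin r)),
      F (xshiftI δ q.1.2 (xshift δ q.2.1 x)) (yshiftMu κ q.1.1 (yshift κ q.2.2 y))
        = G (totalShift q) := by
    intro q
    simp only [G, totalShift]
    congr 1
    · funext i
      simp only [xshift, xshiftI, addInd]
      push_cast
      ring
    · funext j
      simp only [yshift, yshiftMu, addInd]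
      push_cast
      ring
  have key := eq_of_dense_of_continuousAt (dense_isGeneric (m := m) (r := r) hent hnz)
    (p := (x, y, δ, κ)) ?_ ?_ fun p (hp : IsGeneric br p.2.2.1 p.2.2.2 p.1 p.2.1) =>
      hp.sum_Coef_mul_Coef hodd hent hnz hW k l G
  · simp only [Dop, Hop, mul_sum, ← mul_assoc]
    rw [← sum_product', sum_comm, ← sum_product']
    simpa only [hFDH, hFHD] using key
  · refine tendsto_finsetSum _ fun q hq => ContinuousAt.mul (ContinuousAt.mul ?_ ?_)
      continuousAt_const
    · exact continuousAt_Coef hent (by fun_prop) (by fun_prop) (by fun_prop) (by fun_prop) _ _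
        (h1 _ (mem_product.mp hq).1)
    · exact continuousAt_Coef hent (by fun_prop) (by fun_prop)
        (by unfold xshiftI; fun_prop) (by unfold yshiftMu; fun_prop) _ _
        (h3 _ (mem_product.mp hq).1 _ (mem_product.mp hq).2)
  · refine tendsto_finsetSum _ fun q hq => ContinuousAt.mul (ContinuousAt.mul ?_ ?_)
      continuousAt_const
    · exact continuousAt_Coef hent (by fun_prop) (by fun_prop) (by fun_prop) (by fun_prop) _ _
        (h2 _ (mem_product.mp hq).2)
    · exact continuousAt_Coef hent (by fun_prop) (by fun_prop)
        (by unfold yshift; fun_prop) (by unfold xshift; fun_prop) _ _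
        (h4 _ (mem_product.mp hq).2 _ (mem_product.mp hq).1)
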